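/- None of the Narayana numbers N_n with n > 250 is a concatenation of two repdigits. -/

import Mathlib

def narayana : ℕ → ℕ
  | 0 => 0
  | 1 => 1
  | 2 => 1
  | n + 3 => narayana (n + 2) + narayana n

open Polynomial

/-- The norm form of `ℤ[θ]`, `θ³ = θ² + 1`, vanishes only at the origin. -/
theorem cubic_norm_form_eq_zero (a b c : ℤ)
    (h : a ^ 3 + a ^ 2 * b + a ^ 2 * c - 3 * a * b * c - 2 * a * c ^ 2 + b ^ 3 + b ^ 2 * c + c ^ 3
      = 0) : a = 0 ∧ b = 0 ∧ c = 0 := by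
  induction hs : a.natAbs + b.natAbs + c.natAbs using Nat.strong_induction_on
    generalizing a b c with
  | _ s ih =>
  have hpar : ∀ x y z : ZMod 2, x ^ 3 + x ^ 2 * y + x ^ 2 * z - 3 * x * y * z - 2 * x * z ^ 2
      + y ^ 3 + y ^ 2 * z + z ^ 3 = 0 → x = 0 ∧ y = 0 ∧ z = 0 := by decide
  have hz := hpar a b c (by exact_mod_cast congrArg (Int.cast : ℤ → ZMod 2) h)
  simp only [ZMod.intCast_eq_zero_iff_even, even_iff_two_dvd] at hz
  obtain ⟨⟨a', rfl⟩, ⟨b', rfl⟩, ⟨c', rfl⟩⟩ := hz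
  by_cases h0 : s = 0
  · omega
  have := ih (a'.natAbs + b'.natAbs + c'.natAbs) (by omega) a' b' c' (by linarith) rfl
  omega

/-- Liouville's inequality in `ℤ[α]`, where `α` is the real root of `X³ - X² - 1` and `β` is one of
the two complex roots. -/
theorem one_le_abs_aeval_mul_norm_aeval_sq {α : ℝ} {β : ℂ} (hα : α ^ 3 = α ^ 2 + 1)
    (hadd : β + starRingEnd ℂ β = 1 - α) (hmul : β * starRingEnd ℂ β = α ^ 2 - α) (q : ℤ[X])
    (hq : aeval α q ≠ 0) : 1 ≤ |aeval α q| * ‖aeval β q‖ ^ 2 := by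
  have hβ : β ^ 3 = β ^ 2 + 1 := by
    have hα' : (α : ℂ) ^ 3 = α ^ 2 + 1 := by exact_mod_cast hα
    have h2 : β ^ 2 = (1 - α) * β - (α ^ 2 - α) := by linear_combination β * hadd - hmul
    linear_combination (β - α) * h2 + hα' 
  have hm : (X ^ 3 - X ^ 2 - 1 : ℤ[X]).Monic := by monicity!
  have hdeg : (X ^ 3 - X ^ 2 - 1 : ℤ[X]).natDegree = 3 := by compute_degree!
  set p := q %ₘ (X ^ 3 - X ^ 2 - 1 : ℤ[X]) with hp
  have hpd : p.natDegree < 3 := by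
    rw [← hdeg]
    exact natDegree_modByMonic_lt _ hm (fun h => by rw [h] at hdeg; simp at hdeg)
  have hαq : aeval α q = aeval α p := (aeval_modByMonic_eq_self_of_root (by simp [hα])).symm
  have hβq : aeval β q = aeval β p := (aeval_modByMonic_eq_self_of_root (by simp [hβ])).symm
  obtain ⟨a, b, c, habc⟩ : ∃ a b c : ℤ, p = C a + C b * X + C c * X ^ 2 := by
    refine ⟨p.coeff 0, p.coeff 1, p.coeff 2, ?_⟩
    conv_lhs => rw [p.as_sum_range_C_mul_X_pow' hpd]
    simp [Finset.sum_range_succ]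
  rw [hαq] at hq
  rw [hαq, hβq]
  have hαv : aeval α p = a + b * α + c * α ^ 2 := by simp [habc]
  have hβv : aeval β p = a + b * β + c * β ^ 2 := by simp [habc]
  have hnorm : ‖aeval β p‖ ^ 2 = a ^ 2 + a * b * (1 - α) + a * c * ((1 - α) ^ 2 - 2 * (α ^ 2 - α))
      + b ^ 2 * (α ^ 2 - α) + b * c * (α ^ 2 - α) * (1 - α) + c ^ 2 * (α ^ 2 - α) ^ 2 := by
    rw [← Complex.ofReal_inj, Complex.ofReal_pow, ← Complex.mul_conj', hβv]
    simp only [map_add, map_mul, map_pow, map_intCast]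
    push_cast
    rw [← hadd, ← hmul]
    ring
  set v : ℤ := a ^ 3 + a ^ 2 * b + a ^ 2 * c - 3 * a * b * c - 2 * a * c ^ 2 + b ^ 3 + b ^ 2 * c
    + c ^ 3 with hv
  have hprod : aeval α p * ‖aeval β p‖ ^ 2 = v := by
    rw [hnorm, hαv, hv]
    push_cast
    have h4 : α ^ 4 = α ^ 2 + α + 1 := by linear_combination (α + 1) * hα
    have h5 : α ^ 5 = 2 * α ^ 2 + α + 1 := by linear_combination (α ^ 2 + α + 1) * hα
    have h6 : α ^ 6 = 3 * α ^ 2 + α + 2 := by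
      linear_combination (α ^ 3 + α ^ 2 + α + 2) * hα
    ring_nf
    rw [h6, h5, h4, hα]
    ring
  have hv0 : v ≠ 0 := by
    intro h0
    obtain ⟨rfl, rfl, rfl⟩ := cubic_norm_form_eq_zero a b c h0
    exact hq (by simp [hαv])
  calc (1 : ℝ) ≤ |(v : ℝ)| := by exact_mod_cast Int.one_le_abs hv0
    _ = |aeval α p| * ‖aeval β p‖ ^ 2 := by rw [← hprod, abs_mul, abs_of_nonneg (sq_nonneg ‖_‖)]

/-- Dirichlet's box principle for real linear forms in integer variables. -/
theorem exists_int_vector_small_forms {ι κ : Type*} [Fintype ι] [Fintype κ] (a : κ → ι → ℝ)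
    {F : ℝ} (hF : 0 < F) (ha : ∀ m i, |a m i| ≤ F) {Q H : ℕ} (hH : 0 < H)
    (hcard : H ^ Fintype.card κ < Q ^ Fintype.card ι) :
    ∃ p : ι → ℤ, p ≠ 0 ∧ (∀ i, |p i| ≤ Q) ∧
      ∀ m, |∑ i, p i * a m i| ≤ 2 * Fintype.card ι * Q * F / H := by
  classical
  have hN : 0 < Fintype.card ι := by
    by_contra h0
    have : Fintype.card ι = 0 := by omega
    rw [this, pow_zero] at hcard
    have := Nat.pow_pos (n := Fintype.card κ) hH
    omega
  have hQ : 0 < Q := by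
    by_contra h0
    have : Q = 0 := by omega
    rw [this, zero_pow hN.ne'] at hcard
    omega
  have hHR : (0 : ℝ) < H := by exact_mod_cast hH
  set W : ℝ := Fintype.card ι * Q * F with hW
  have hW0 : 0 < W := by positivity
  let φ : (ι → Fin Q) → κ → ℝ := fun p m => ∑ i, ((p i : ℕ) : ℝ) * a m i
  have hφ : ∀ p m, |φ p m| < W := by
    intro p m
    calc |φ p m| ≤ ∑ i, |((p i : ℕ) : ℝ) * a m i| := Finset.abs_sum_le_sum_abs _ _
      _ < ∑ _i : ι, (Q : ℝ) * F := by
        have : Nonempty ι := Fintype.card_pos_iff.mp hN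
        refine Finset.sum_lt_sum_of_nonempty Finset.univ_nonempty fun i _ => ?_
        rw [abs_mul, Nat.abs_cast]
        have h1 : ((p i : ℕ) : ℝ) < Q := by exact_mod_cast (p i).2
        calc ((p i : ℕ) : ℝ) * |a m i| ≤ ((p i : ℕ) : ℝ) * F := by gcongr; exact ha m i
          _ < Q * F := by gcongr
      _ = W := by simp [hW, mul_assoc]
  let y : (ι → Fin Q) → κ → ℝ := fun p m => (φ p m + W) * H / (2 * W)
  have hy0 : ∀ p m, 0 ≤ y p m := fun p m => by
    have := (abs_lt.mp (hφ p m)).1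
    exact div_nonneg (mul_nonneg (by linarith) hHR.le) (by positivity)
  have hyH : ∀ p m, y p m < H := fun p m => by
    have := (abs_lt.mp (hφ p m)).2
    rw [div_lt_iff₀ (by positivity)]
    nlinarith
  let Φ : (ι → Fin Q) → κ → Fin H := fun p m =>
    ⟨⌊y p m⌋₊, (Nat.floor_lt (hy0 p m)).mpr (hyH p m)⟩
  obtain ⟨p, q, hpq, hΦ⟩ := Fintype.exists_ne_map_eq_of_card_lt Φ (by simpa using hcard)
  refine ⟨fun i => (p i : ℤ) - (q i : ℤ), ?_, ?_, ?_⟩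
  · intro h
    apply hpq
    ext i
    have := congrFun h i
    simp only [Pi.zero_apply] at this
    omega
  · intro i
    have h1 := (p i).2
    have h2 := (q i).2
    change |((p i : ℕ) : ℤ) - ((q i : ℕ) : ℤ)| ≤ _
    rw [abs_le]
    constructor <;> omega
  · intro m
    have hfl : ⌊y p m⌋₊ = ⌊y q m⌋₊ := by
      have := congrFun hΦ m
      simpa [Φ] using this
    have h1 := Nat.floor_le (hy0 p m)
    have h2 := Nat.lt_floor_add_one (y p m)
    have h3 := Nat.floor_le (hy0 q m)
    have h4 := Nat.lt_floor_add_one (y q m)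
    rw [hfl] at h1 h2
    have hd : |y p m - y q m| ≤ 1 := by rw [abs_le]; constructor <;> linarith
    have hsum : ∑ i, (((p i : ℤ) - (q i : ℤ) : ℤ) : ℝ) * a m i = (y p m - y q m) * (2 * W / H) := by
      have : φ p m - φ q m = (y p m - y q m) * (2 * W / H) := by
        simp only [y]
        field_simp
        ring
      rw [← this, ← Finset.sum_sub_distrib]
      refine Finset.sum_congr rfl fun i _ => ?_
      push_cast
      ring
    rw [hsum, abs_mul, abs_of_nonneg (by positivity : 0 ≤ 2 * W / H)]
    calc |y p m - y q m| * (2 * W / H) ≤ 1 * (2 * W / H) := by gcongr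
      _ = _ := by rw [hW]; ring

/-- Truncation of the power series of `P(u) exp(ν u)`, with bounds for the coefficients and for the
remainder on the unit interval in terms of a majorant on the disc of radius `E`. -/
theorem exists_truncation_eval_mul_exp (P : ℝ[X]) {ν E F : ℝ} (hν : 0 ≤ ν) (hE : 1 ≤ E)
    (hF : (∑ a ∈ P.support, |P.coeff a| * E ^ a) * Real.exp (E * ν) ≤ F) (M : ℕ) :
    ∃ A : ℕ → ℝ, (∀ m, |A m| ≤ F) ∧ ∀ u ∈ Set.Icc (0 : ℝ) 1,
      |P.eval u * Real.exp (ν * u) - ∑ m ∈ Finset.range M, A m * u ^ m| ≤ F / E ^ M := by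
  have hE0 : 0 < E := by linarith
  have hexp : ∀ z : ℝ, HasSum (fun j : ℕ => z ^ j / j.factorial) (Real.exp z) := fun z => by
    rw [Real.exp_eq_exp_ℝ]; exact NormedSpace.expSeries_div_hasSum_exp z
  have hfin : ∀ g : ℕ → ℝ, (∀ a ∉ P.support, g a = 0) → HasSum g (∑ a ∈ P.support, g a) :=
    fun g hg => hasSum_sum_of_ne_finset_zero hg
  let A : ℕ → ℝ := fun m => ∑ z ∈ Finset.HasAntidiagonal.antidiagonal m, P.coeff z.1 * (ν ^ z.2 / z.2.factorial)
  let D : ℕ → ℝ := fun m => ∑ z ∈ Finset.HasAntidiagonal.antidiagonal m,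
    (|P.coeff z.1| * E ^ z.1) * ((E * ν) ^ z.2 / z.2.factorial)
  have hD0 : ∀ m, 0 ≤ D m := fun m => Finset.sum_nonneg fun z _ => by positivity
  have hAD : ∀ m, |A m| * E ^ m ≤ D m := by
    intro m
    calc |A m| * E ^ m ≤ (∑ z ∈ Finset.HasAntidiagonal.antidiagonal m,
          |P.coeff z.1 * (ν ^ z.2 / z.2.factorial)|) * E ^ m := by
          gcongr; exact Finset.abs_sum_le_sum_abs _ _
      _ = D m := by
          rw [Finset.sum_mul]
          refine Finset.sum_congr rfl fun z hz => ?_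
          rw [abs_mul, abs_of_nonneg (by positivity : 0 ≤ ν ^ z.2 / (z.2.factorial : ℝ)),
            ← Finset.HasAntidiagonal.mem_antidiagonal.mp hz, pow_add, mul_pow]
          ring
  have hsD : Summable D ∧ ∑' m, D m ≤ F := by
    have h1 := hfin (fun a => |P.coeff a| * E ^ a) (fun a ha => by
      simp [notMem_support_iff.mp ha])
    have h2 := hexp (E * ν)
    have hn1 : Summable fun a => ‖|P.coeff a| * E ^ a‖ := by
      refine h1.summable.congr fun a => (Real.norm_of_nonneg (by positivity)).symm
    have hn2 : Summable fun j : ℕ => ‖(E * ν) ^ j / (j.factorial : ℝ)‖ := by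
      refine h2.summable.congr fun a => (Real.norm_of_nonneg (by positivity)).symm
    refine ⟨(summable_norm_sum_mul_antidiagonal_of_summable_norm hn1 hn2).of_norm, ?_⟩
    rw [← tsum_mul_tsum_eq_tsum_sum_antidiagonal_of_summable_norm hn1 hn2, h1.tsum_eq, h2.tsum_eq]
    exact hF
  have hDle : ∀ m, D m ≤ F := fun m =>
    (hsD.1.le_tsum m fun j _ => hD0 j).trans hsD.2
  refine ⟨A, fun m => ?_, fun u hu => ?_⟩
  · have : |A m| * 1 ≤ |A m| * E ^ m := by gcongr; exact one_le_pow₀ hE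
    linarith [hAD m, hDle m]
  · have hs : HasSum (fun m => A m * u ^ m) (P.eval u * Real.exp (ν * u)) := by
      have h1 := hfin (fun a => P.coeff a * u ^ a) (fun a ha => by
        simp [notMem_support_iff.mp ha])
      have h2 := hexp (ν * u)
      rw [show ∑ a ∈ P.support, P.coeff a * u ^ a = P.eval u from (eval_eq_sum).symm] at h1
      have hn1 : Summable fun a => ‖P.coeff a * u ^ a‖ := by
        refine (hfin (fun a => ‖P.coeff a * u ^ a‖) fun a ha => ?_).summable
        simp [notMem_support_iff.mp ha]
      have hn2 : Summable fun j : ℕ => ‖(ν * u) ^ j / (j.factorial : ℝ)‖ := by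
        refine h2.summable.congr fun a => (Real.norm_of_nonneg ?_).symm
        have := hu.1
        positivity
      have hsum := (summable_norm_sum_mul_antidiagonal_of_summable_norm hn1 hn2).of_norm.hasSum
      rw [← tsum_mul_tsum_eq_tsum_sum_antidiagonal_of_summable_norm hn1 hn2, h1.tsum_eq,
        h2.tsum_eq] at hsum
      refine hsum.congr_fun fun m => ?_
      rw [Finset.sum_mul]
      refine Finset.sum_congr rfl fun z hz => ?_
      rw [← Finset.HasAntidiagonal.mem_antidiagonal.mp hz, pow_add, mul_pow]
      ring
    have htail := (hasSum_nat_add_iff' M).mpr hs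
    have hb : ∀ m, ‖A (m + M) * u ^ (m + M)‖ ≤ D (m + M) / E ^ M := by
      intro m
      rw [norm_mul, Real.norm_eq_abs, norm_pow, Real.norm_of_nonneg hu.1, le_div_iff₀ (by positivity)]
      calc |A (m + M)| * u ^ (m + M) * E ^ M ≤ |A (m + M)| * 1 * E ^ (m + M) := by
            gcongr
            · exact pow_le_one₀ hu.1 hu.2
            omega
        _ ≤ D (m + M) := by rw [mul_one]; exact hAD _
    have hsum2 : Summable fun m => D (m + M) := (summable_nat_add_iff M).mpr hsD.1
    rw [← Real.norm_eq_abs]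
    refine (htail.norm_le_of_bounded (hsum2.div_const _).hasSum hb).trans ?_
    rw [tsum_div_const]
    gcongr
    refine le_trans ?_ hsD.2
    rw [← hsD.1.sum_add_tsum_nat_add M]
    linarith [Finset.sum_nonneg fun m (_ : m ∈ Finset.range M) => hD0 m]

/-- An integer combination of functions `P i (u) exp(ν i u)` with small coefficients which is very
small on the whole unit interval. -/
theorem exists_int_combination_small {ι : Type*} [Fintype ι] (P : ι → ℝ[X]) {ν : ι → ℝ}
    {E m : ℕ} {F : ℝ} (hν : ∀ i, 0 ≤ ν i) (hE : 1 < E) (hm : 0 < m) (hF0 : 0 < F)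
    (hF : ∀ i, (∑ a ∈ (P i).support, |(P i).coeff a| * (E : ℝ) ^ a) * Real.exp (E * ν i) ≤ F)
    (hcard : 36 * m < Fintype.card ι) :
    ∃ p : ι → ℤ, p ≠ 0 ∧ (∀ i, |p i| ≤ (E : ℤ) ^ m) ∧ ∀ u ∈ Set.Icc (0 : ℝ) 1,
      |∑ i, p i * ((P i).eval u * Real.exp (ν i * u))|
        ≤ (12 * m + 1) * Fintype.card ι * F / (E : ℝ) ^ (5 * m) := by
  have hE1 : (1 : ℝ) ≤ E := by exact_mod_cast hE.le
  choose A hA hAr using fun i =>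
    exists_truncation_eval_mul_exp (P i) (hν i) hE1 (hF i) (6 * m)
  obtain ⟨p, hp0, hpQ, hp⟩ := exists_int_vector_small_forms (ι := ι) (κ := Fin (6 * m))
    (fun k i => A i k) hF0 (fun k i => hA i k) (Q := E ^ m) (H := E ^ (6 * m)) (by positivity) (by
      rw [← pow_mul, ← pow_mul, Fintype.card_fin]
      refine Nat.pow_lt_pow_right hE ?_
      nlinarith)
  push_cast at hpQ hp
  refine ⟨p, hp0, hpQ, fun u hu => ?_⟩
  have hsplit : ∑ i, p i * ((P i).eval u * Real.exp (ν i * u))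
      = ∑ i, p i * ((P i).eval u * Real.exp (ν i * u) - ∑ k ∈ Finset.range (6 * m), A i k * u ^ k)
        + ∑ k : Fin (6 * m), (∑ i, p i * A i k) * u ^ (k : ℕ) := by
    have : ∑ k : Fin (6 * m), (∑ i, p i * A i k) * u ^ (k : ℕ)
        = ∑ i, p i * ∑ k ∈ Finset.range (6 * m), A i k * u ^ k := by
      simp_rw [← Fin.sum_univ_eq_sum_range (fun k => A _ k * u ^ k), Finset.mul_sum,
        Finset.sum_mul]
      rw [Finset.sum_comm]
      simp only [mul_assoc]
    rw [this, ← Finset.sum_add_distrib]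
    refine Finset.sum_congr rfl fun i _ => by ring
  have hEpos : (0 : ℝ) < E := by linarith
  have hE6 : (E : ℝ) ^ (6 * m) = E ^ m * E ^ (5 * m) := by rw [← pow_add]; congr 1; ring
  have h1 : |∑ i, p i * ((P i).eval u * Real.exp (ν i * u)
      - ∑ k ∈ Finset.range (6 * m), A i k * u ^ k)| ≤ Fintype.card ι * F / (E : ℝ) ^ (5 * m) := by
    calc _ ≤ ∑ i, |p i * ((P i).eval u * Real.exp (ν i * u)
      - ∑ k ∈ Finset.range (6 * m), A i k * u ^ k)| := Finset.abs_sum_le_sum_abs _ _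
      _ ≤ ∑ _i : ι, (E : ℝ) ^ m * (F / (E : ℝ) ^ (6 * m)) := by
        refine Finset.sum_le_sum fun i _ => ?_
        rw [abs_mul]
        refine mul_le_mul ?_ (hAr i u hu) (abs_nonneg _) (by positivity)
        exact_mod_cast hpQ i
      _ = _ := by
        rw [Finset.sum_const, Finset.card_univ, nsmul_eq_mul, hE6]
        field_simp
  have h2 : |∑ k : Fin (6 * m), (∑ i, p i * A i k) * u ^ (k : ℕ)|
      ≤ 12 * m * Fintype.card ι * F / (E : ℝ) ^ (5 * m) := by
    calc _ ≤ ∑ k : Fin (6 * m), |(∑ i, p i * A i k) * u ^ (k : ℕ)| :=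
          Finset.abs_sum_le_sum_abs _ _
      _ ≤ ∑ _k : Fin (6 * m), 2 * Fintype.card ι * (E : ℝ) ^ m * F / (E : ℝ) ^ (6 * m) * 1 := by
        refine Finset.sum_le_sum fun k _ => ?_
        rw [abs_mul]
        refine mul_le_mul (hp k) ?_ (abs_nonneg _) (by positivity)
        rw [abs_of_nonneg (pow_nonneg hu.1 _)]
        exact pow_le_one₀ hu.1 hu.2
      _ = _ := by
        rw [Finset.sum_const, Finset.card_univ, Fintype.card_fin, nsmul_eq_mul, hE6]
        push_cast
        field_simp
        ring
  rw [hsplit]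
  refine (abs_add_le _ _).trans ((add_le_add h1 h2).trans (le_of_eq ?_))
  ring

theorem coeff_prod_sum_of_natDegree_le {ι : Type*} (s : Finset ι) (f : ι → ℝ[X]) (d : ι → ℕ)
    (h : ∀ i ∈ s, (f i).natDegree ≤ d i) :
    (∏ i ∈ s, f i).coeff (∑ i ∈ s, d i) = ∏ i ∈ s, (f i).coeff (d i) := by
  classical
  induction s using Finset.induction_on with
  | empty => simp
  | insert a s ha ih =>
    rw [Finset.prod_insert ha, Finset.sum_insert ha, Finset.prod_insert ha,
      coeff_mul_add_eq_of_natDegree_le (h a (Finset.mem_insert_self a s)), ih]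
    · exact fun i hi => h i (Finset.mem_insert_of_mem hi)
    · refine (natDegree_prod_le _ _).trans (Finset.sum_le_sum fun i hi => ?_)
      exact h i (Finset.mem_insert_of_mem hi)

/-- Zero estimate: polynomials `P l`, `l < L`, of degree less than `K`, such that
`∑ l, P l (r + s k) (x ^ r ρ ^ s) ^ l` vanishes at all `r < R`, `s < S`, are all zero. -/
theorem eq_zero_of_sum_eval_mul_pow_eq_zero {K L R S k : ℕ} {x ρ : ℝ} (hx : 1 < x) (hρ : ρ ≠ 0)
    (hRk : R ≤ k) (hLR : L ≤ R) (hcard : L * (K - 1) < (R - L + 1) * S) (P : Fin L → ℝ[X])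
    (hdeg : ∀ l, (P l).natDegree < K)
    (hzero : ∀ r < R, ∀ s < S,
      ∑ l, (P l).eval (r + s * k : ℝ) * (x ^ r * ρ ^ s) ^ (l : ℕ) = 0) :
    ∀ l, P l = 0 := by
  by_contra! hne
  obtain ⟨l₀, hl₀⟩ := hne
  let ι := {l : Fin L // P l ≠ 0}
  let e : ι ≃ Fin (Fintype.card ι) := Fintype.equivFin ι
  have hν : Fintype.card ι ≤ L := by
    simpa only [Fintype.card_fin] using Fintype.card_subtype_le fun l => P l ≠ 0
  let M : Matrix ι ι ℝ[X] := fun i j =>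
    (P j).comp (X + C ((e i : ℕ) : ℝ)) * C (x ^ ((j : Fin L) * (e i : ℕ) : ℕ))
  have hMdeg : ∀ i j, (M i j).natDegree ≤ (P j).natDegree := by
    intro i j
    refine (natDegree_mul_C_le _ _).trans ?_
    rw [natDegree_comp, natDegree_X_add_C, mul_one]
  have hdet : M.det = ∑ σ : Equiv.Perm ι, (Equiv.Perm.sign σ : ℤ) • ∏ j, M (σ j) j := by
    rw [Matrix.det_apply]; rfl
  have hdetdeg : M.det.natDegree ≤ ∑ j : ι, (P j).natDegree := by
    rw [hdet]
    refine natDegree_sum_le_of_forall_le _ _ fun σ _ => ?_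
    refine (natDegree_smul_le _ _).trans ((natDegree_prod_le _ _).trans ?_)
    exact Finset.sum_le_sum fun j _ => hMdeg _ _
  have hMcoeff : ∀ i j, (M i j).coeff (P j).natDegree
      = (P j).leadingCoeff * (x ^ ((j : Fin L) : ℕ)) ^ (e i : ℕ) := by
    intro i j
    have : (P j).natDegree = ((P j).comp (X + C ((e i : ℕ) : ℝ))).natDegree := by
      rw [natDegree_comp, natDegree_X_add_C, mul_one]
    rw [coeff_mul_C, this, coeff_natDegree, leadingCoeff_comp (by rw [natDegree_X_add_C]; simp),
      leadingCoeff_X_add_C, one_pow, mul_one, pow_mul]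
  have hcoeff : M.det.coeff (∑ j : ι, (P j).natDegree)
      = (∏ j : ι, (P j).leadingCoeff) *
        (Matrix.vandermonde fun j : Fin (Fintype.card ι) =>
          x ^ (((e.symm j : ι) : Fin L) : ℕ)).det := by
    have hv : (Matrix.vandermonde fun j : Fin (Fintype.card ι) =>
          x ^ (((e.symm j : ι) : Fin L) : ℕ)).det
        = (Matrix.of fun i j : ι => (x ^ ((j : Fin L) : ℕ)) ^ (e i : ℕ)).det := by
      rw [← Matrix.det_transpose, ← Matrix.det_reindex_self e.symm]
      congr 1
      ext i j
      simp [Matrix.vandermonde]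
    rw [hv, hdet, finsetSum_coeff, Matrix.det_apply, Finset.mul_sum]
    refine Finset.sum_congr rfl fun σ _ => ?_
    rw [coeff_smul, coeff_prod_sum_of_natDegree_le _ _ _ fun j _ => hMdeg _ _]
    simp_rw [hMcoeff, Finset.prod_mul_distrib]
    simp only [Matrix.of_apply, Units.smul_def, mul_smul_comm]
  have hdet0 : M.det ≠ 0 := by
    intro h0
    rw [h0, coeff_zero] at hcoeff
    rcases mul_eq_zero.mp hcoeff.symm with h | h
    · obtain ⟨j, -, hj⟩ := Finset.prod_eq_zero_iff.mp h
      exact j.2 (leadingCoeff_eq_zero.mp hj)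
    · refine (Matrix.det_vandermonde_ne_zero_iff.mpr fun i j hij => ?_) h
      have := pow_right_injective₀ (by linarith) hx.ne' hij
      exact e.symm.injective (Subtype.ext (Fin.ext this))
  have hroot : ∀ r < R - L + 1, ∀ s < S, M.det.eval (r + s * k : ℝ) = 0 := by
    intro r hr s hs
    rw [← coe_evalRingHom, RingHom.map_det]
    refine Matrix.exists_mulVec_eq_zero_iff.mp
      ⟨fun j => (x ^ r * ρ ^ s) ^ ((j : Fin L) : ℕ), ?_, ?_⟩
    · intro h
      have := congrFun h ⟨l₀, hl₀⟩
      simp only [Pi.zero_apply] at this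
      have hx0 : 0 < x := by linarith
      exact pow_ne_zero _ (mul_ne_zero (pow_ne_zero _ hx0.ne') (pow_ne_zero _ hρ)) this
    · ext i
      have hi : (e i : ℕ) < L := (e i).2.trans_le hν
      have h := hzero (r + e i) (by omega) s hs
      rw [Pi.zero_apply, ← h]
      symm
      simp only [Matrix.mulVec, dotProduct, RingHom.mapMatrix_apply, Matrix.map_apply]
      refine (Finset.sum_filter_of_ne fun l _ hl => ?_).symm.trans
        ((Finset.sum_subtype (Finset.univ.filter fun l => P l ≠ 0) (by simp) _).trans
        (Finset.sum_congr rfl fun j _ => ?_))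
      · rintro h0
        simp [h0] at hl
      · simp only [M, coe_evalRingHom, eval_mul, eval_comp, eval_add, eval_X, eval_C]
        rw [show ((r + (e i : ℕ) : ℕ) + s * k : ℝ) = r + s * k + (e i : ℕ) by push_cast; ring]
        rw [pow_add, pow_mul]
        simp only [mul_pow]
        rw [← pow_mul x (e i : ℕ), ← pow_mul x _ (e i : ℕ), mul_comm (e i : ℕ)]
        ring
  have hinj : Set.InjOn (fun z : ℕ × ℕ => (z.1 + z.2 * k : ℝ))
      (Finset.range (R - L + 1) ×ˢ Finset.range S : Finset (ℕ × ℕ)) := by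
    rintro ⟨r, s⟩ h ⟨r', s'⟩ h' heq
    simp only [Finset.coe_product, Finset.coe_range, Set.mem_prod, Set.mem_Iio] at h h'
    replace heq : r + s * k = r' + s' * k := by
      simp only at heq
      exact_mod_cast heq
    by_cases hL : L = 0
    · exact absurd l₀.2 (by omega)
    have hr : r < k := by omega
    have hr' : r' < k := by omega
    have h1 : r = r' := by
      simpa [Nat.add_mul_mod_self_right, Nat.mod_eq_of_lt hr, Nat.mod_eq_of_lt hr'] using
        congrArg (· % k) heq
    subst h1
    have : s = s' := Nat.eq_of_mul_eq_mul_right (by omega : 0 < k) (by omega)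
    rw [this]
  have hle : (R - L + 1) * S ≤ M.det.natDegree := by
    have h := Finset.card_le_card (s := (Finset.range (R - L + 1) ×ˢ Finset.range S).image
      fun z : ℕ × ℕ => (z.1 + z.2 * k : ℝ)) (t := M.det.roots.toFinset) ?_
    · rw [Finset.card_image_of_injOn hinj, Finset.card_product, Finset.card_range,
        Finset.card_range] at h
      exact h.trans ((Multiset.toFinset_card_le _).trans (card_roots' _))
    · intro y hy
      obtain ⟨z, hz, rfl⟩ := Finset.mem_image.mp hy
      rw [Finset.mem_product, Finset.mem_range, Finset.mem_range] at hz
      rw [Multiset.mem_toFinset, mem_roots hdet0]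
      exact hroot _ hz.1 _ hz.2
  have hsum : ∑ j : ι, (P j).natDegree ≤ L * (K - 1) := by
    calc ∑ j : ι, (P j).natDegree ≤ ∑ _j : ι, (K - 1) :=
          Finset.sum_le_sum fun j _ => by have := hdeg j; omega
      _ = Fintype.card ι * (K - 1) := by simp
      _ ≤ L * (K - 1) := Nat.mul_le_mul_right _ hν
  omega

/-- Coefficientwise domination of the falling by the rising factorial. -/
theorem abs_coeff_descPochhammer_le (n a : ℕ) :
    |(descPochhammer ℝ n).coeff a| ≤ (ascPochhammer ℝ n).coeff a := by
  induction n generalizing a with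
  | zero =>
    rw [descPochhammer_zero, ascPochhammer_zero, coeff_one]
    split_ifs <;> simp
  | succ n ih =>
    rw [descPochhammer_succ_right, ascPochhammer_succ_right, ← C_eq_natCast]
    have hn : (0 : ℝ) ≤ n := n.cast_nonneg
    cases a with
    | zero =>
      simp only [mul_coeff_zero, coeff_sub, coeff_add, coeff_X_zero, coeff_C_zero, zero_sub,
        zero_add, mul_neg, abs_neg, abs_mul, Nat.abs_cast]
      gcongr
      exact ih 0
    | succ a =>
      rw [mul_sub, mul_add, coeff_sub, coeff_add, coeff_mul_X, coeff_mul_X, coeff_mul_C,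
        coeff_mul_C]
      refine (abs_sub _ _).trans (add_le_add (ih a) ?_)
      rw [abs_mul, Nat.abs_cast]
      gcongr
      exact ih _

theorem ascPochhammer_eval_le_pow {y : ℝ} (hy : 0 ≤ y) (n : ℕ) :
    0 ≤ (ascPochhammer ℝ n).eval y ∧ (ascPochhammer ℝ n).eval y ≤ (y + n) ^ n := by
  induction n with
  | zero => simp
  | succ n ih =>
    rw [ascPochhammer_succ_right, eval_mul, eval_add, eval_X, eval_natCast, pow_succ]
    refine ⟨mul_nonneg ih.1 (by positivity), ?_⟩
    push_cast
    refine mul_le_mul (ih.2.trans ?_) (by linarith) (by positivity) (by positivity)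
    gcongr
    linarith

/-- The polynomial `X ↦ binom(T X, i)`. -/
noncomputable def scaledBinom (T : ℝ) (i : ℕ) : ℝ[X] :=
  C ((i.factorial : ℝ)⁻¹) * (descPochhammer ℝ i).comp (C T * X)

theorem scaledBinom_eval (T u : ℝ) (i t : ℕ) (h : T * u = t) :
    (scaledBinom T i).eval u = t.choose i := by
  rw [scaledBinom, eval_mul, eval_C, eval_comp, eval_mul, eval_C, eval_X, h,
    descPochhammer_eval_eq_descFactorial, Nat.descFactorial_eq_factorial_mul_choose]
  push_cast
  field_simp

theorem scaledBinom_majorant {T E : ℝ} (hT : 0 ≤ T) (hE : 0 ≤ E) (i : ℕ) :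
    ∑ a ∈ (scaledBinom T i).support, |(scaledBinom T i).coeff a| * E ^ a
      ≤ (E * T + i) ^ i / i.factorial := by
  have hcoeff : ∀ a, |(scaledBinom T i).coeff a| * E ^ a
      ≤ (ascPochhammer ℝ i).coeff a * (E * T) ^ a / i.factorial := by
    intro a
    rw [scaledBinom, coeff_C_mul, comp_C_mul_X_coeff, abs_mul, abs_mul, abs_pow, abs_of_nonneg hT,
      abs_of_nonneg (by positivity : 0 ≤ ((i.factorial : ℝ)⁻¹))]
    calc _ = |(descPochhammer ℝ i).coeff a| * (E * T) ^ a / i.factorial := by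
          rw [mul_pow]; field_simp
      _ ≤ _ := by gcongr; exact abs_coeff_descPochhammer_le i a
  have hnn : ∀ a, 0 ≤ (ascPochhammer ℝ i).coeff a := fun a =>
    (abs_nonneg _).trans (abs_coeff_descPochhammer_le i a)
  have hsub : (scaledBinom T i).support ⊆ Finset.range (i + 1) := by
    intro a ha
    rw [Finset.mem_range]
    by_contra hlt
    rw [mem_support_iff, scaledBinom, coeff_C_mul, comp_C_mul_X_coeff,
      coeff_eq_zero_of_natDegree_lt (by rw [descPochhammer_natDegree]; omega)] at ha
    simp at ha
  calc _ ≤ ∑ a ∈ Finset.range (i + 1), |(scaledBinom T i).coeff a| * E ^ a :=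
        Finset.sum_le_sum_of_subset_of_nonneg hsub fun _ _ _ => by positivity
    _ ≤ ∑ a ∈ Finset.range (i + 1), (ascPochhammer ℝ i).coeff a * (E * T) ^ a / i.factorial :=
        Finset.sum_le_sum fun a _ => hcoeff a
    _ = (ascPochhammer ℝ i).eval (E * T) / i.factorial := by
        rw [← Finset.sum_div, eval_eq_sum_range' (n := i + 1)]
        rw [ascPochhammer_natDegree]; omega
    _ ≤ _ := by gcongr; exact (ascPochhammer_eval_le_pow (by positivity) i).2

theorem natDegree_scaledBinom {T : ℝ} (hT : T ≠ 0) (i : ℕ) : (scaledBinom T i).natDegree = i := by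
  rw [scaledBinom, natDegree_C_mul (by positivity), natDegree_comp, natDegree_C_mul_X _ hT,
    descPochhammer_natDegree, mul_one]

theorem linearIndependent_scaledBinom {T : ℝ} (hT : T ≠ 0) :
    LinearIndependent ℝ (scaledBinom T) := by
  have h0 : ∀ i, scaledBinom T i ≠ 0 := fun i =>
    mul_ne_zero (by simp [Nat.factorial_ne_zero]) fun h => by
      have hd := natDegree_scaledBinom hT i
      rw [scaledBinom, h, mul_zero, natDegree_zero] at hd
      subst hd
      simp at h
  exact Polynomial.Sequence.linearIndependent
    ⟨scaledBinom T, fun i => by rw [degree_eq_natDegree (h0 i), natDegree_scaledBinom hT]⟩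

theorem cleared_monomial_real {α x ρ : ℝ} {A N r₀ s d L S R l r t : ℕ}
    (hx : x = α ^ N / 10 ^ A) (hρ : ρ = 10 ^ s * (d * (3 * α - 2) * α ^ r₀) / 9)
    (hl : l ≤ L) (hr : r ≤ R) (ht : t ≤ S) :
    ((10 ^ (A * L * R - A * l * r + s * l * t) * 9 ^ (L * S - l * t) * d ^ (l * t) : ℕ) : ℝ)
        * (α ^ (N * l * r + r₀ * l * t) * (3 * α - 2) ^ (l * t))
      = 10 ^ (A * L * R) * 9 ^ (L * S) * (x ^ r * ρ ^ t) ^ l := by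
  have h1 : A * l * r ≤ A * L * R := by gcongr
  have h2 : l * t ≤ L * S := by gcongr
  have e1 : (10 : ℝ) ^ (A * L * R) = 10 ^ (A * L * R - A * l * r) * 10 ^ (A * l * r) := by
    rw [← pow_add]; congr 1; omega
  have e2 : (9 : ℝ) ^ (L * S) = 9 ^ (L * S - l * t) * 9 ^ (l * t) := by
    rw [← pow_add]; congr 1; omega
  rw [e1, e2, hx, hρ]
  push_cast
  simp only [div_pow, mul_pow, pow_add, ← pow_mul]
  rw [show A * r * l = A * l * r by ring, show N * r * l = N * l * r by ring,
    show s * t * l = s * l * t by ring, show r₀ * t * l = r₀ * l * t by ring,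
    show t * l = l * t by ring]
  field_simp

theorem norm_cleared_monomial_le {β : ℂ} (hβ : ‖β‖ ≤ 1) {A N r₀ s d L S R l r t : ℕ}
    (hd : d ≤ 9) (hl : l ≤ L) (ht : t ≤ S) :
    ‖((10 ^ (A * L * R - A * l * r + s * l * t) * 9 ^ (L * S - l * t) * d ^ (l * t) : ℕ) : ℂ)
        * (β ^ (N * l * r + r₀ * l * t) * (3 * β - 2) ^ (l * t))‖
      ≤ 10 ^ (A * L * R) * 10 ^ (s * L * S) * 45 ^ (L * S) := by
  have h2 : l * t ≤ L * S := by gcongr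
  have h5 : ‖3 * β - 2‖ ≤ 5 := by
    refine (norm_sub_le _ _).trans ?_
    rw [norm_mul]
    norm_num
    linarith
  rw [norm_mul, norm_mul, norm_pow, norm_pow, Complex.norm_natCast]
  push_cast
  have hd' : (d : ℝ) ≤ 9 := by exact_mod_cast hd
  calc (10 : ℝ) ^ (A * L * R - A * l * r + s * l * t) * 9 ^ (L * S - l * t) * d ^ (l * t)
        * (‖β‖ ^ (N * l * r + r₀ * l * t) * ‖3 * β - 2‖ ^ (l * t))
      ≤ 10 ^ (A * L * R + s * L * S) * 9 ^ (L * S - l * t) * 9 ^ (l * t)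
        * (1 * 5 ^ (L * S)) := by
        gcongr ?_ * _ * ?_ * (?_ * ?_)
        · refine pow_le_pow_right₀ (by norm_num) ?_
          have : s * l * t ≤ s * L * S := by gcongr
          omega
        · gcongr
        · exact pow_le_one₀ (norm_nonneg _) hβ
        · calc ‖3 * β - 2‖ ^ (l * t) ≤ 5 ^ (l * t) := by gcongr
            _ ≤ 5 ^ (L * S) := pow_le_pow_right₀ (by norm_num) h2
    _ = 10 ^ (A * L * R) * 10 ^ (s * L * S) * 45 ^ (L * S) := by
        have e2 : (9 : ℝ) ^ (L * S) = 9 ^ (L * S - l * t) * 9 ^ (l * t) := by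
          rw [← pow_add]; congr 1; omega
        rw [show (45 : ℝ) = 9 * 5 by norm_num, mul_pow, e2, pow_add]
        ring

/-- The transcendence argument: a multiplicative relation between `α`, `10` and `3 α - 2` cannot
hold too precisely. Here `x` and `ρ` are multiplicatively `exp w` and `exp (k w + lam)`. -/
theorem interpolation_contradiction {α : ℝ} {β : ℂ} (hα : α ^ 3 = α ^ 2 + 1)
    (hadd : β + starRingEnd ℂ β = 1 - α) (hmul : β * starRingEnd ℂ β = α ^ 2 - α)
    (hβ : ‖β‖ ≤ 1) {x ρ w lam : ℝ} {A N r₀ s d k L K S R E m : ℕ} {F : ℝ}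
    (hx : x = α ^ N / 10 ^ A) (hρ : ρ = 10 ^ s * (d * (3 * α - 2) * α ^ r₀) / 9) (hd : d ≤ 9)
    (hw : 0 < w) (hxw : x = Real.exp w) (hρw : ρ = Real.exp (k * w + lam))
    (hRk : R ≤ k) (hLR : L ≤ R) (hzc : L * (K - 1) < (R - L + 1) * S) (hcard : 36 * m < K * L)
    (hm : 0 < m) (hE : 1 < E)
    (hF : ∀ i < K, (E * (R + S * k : ℝ) + i) ^ i / i.factorial * Real.exp (E * (L * w * (R + S * k)))
      ≤ F)
    (hlam : L * S * |lam| ≤ 1)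
    (hfin : 10 ^ (A * L * R) * 9 ^ (L * S) * ((K * L : ℕ) * F * ((12 * m + 1) / (E : ℝ) ^ (5 * m)
        + 2 * (E : ℝ) ^ m * (L * S * |lam|)))
      * ((K * L : ℕ) * (E : ℝ) ^ m * F
        * (10 ^ (A * L * R) * 10 ^ (s * L * S) * 45 ^ (L * S))) ^ 2 < 1) : False := by
  set T : ℝ := R + S * k with hT
  have hKpos : 0 < K := Nat.pos_of_ne_zero (by rintro rfl; omega)
  have hLpos : 0 < L := Nat.pos_of_ne_zero (by rintro rfl; omega)
  have hRpos : 0 < R := by omega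
  have hTpos : 0 < T := by
    have : (0 : ℝ) < R := by exact_mod_cast hRpos
    positivity
  have hE1 : (1 : ℝ) ≤ E := by exact_mod_cast hE.le
  have hF0 : 0 < F := lt_of_lt_of_le (by positivity) (hF 0 hKpos)
  obtain ⟨p, hp0, hpE, hp⟩ := exists_int_combination_small
    (ι := Fin K × Fin L) (fun i => scaledBinom T i.1) (ν := fun i => (i.2 : ℕ) * w * T)
    (E := E) (m := m) (F := F) (fun i => by positivity) hE hm hF0 (fun i => by
      refine le_trans ?_ (hF i.1 i.1.2)
      gcongr
      · exact scaledBinom_majorant hTpos.le (by positivity) _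
      · exact i.2.2.le) (by simpa using hcard)
  simp only [Fintype.card_prod, Fintype.card_fin] at hp
  have hpE' : ∀ i, |(p i : ℝ)| ≤ (E : ℝ) ^ m := fun i => by exact_mod_cast hpE i
  -- binomial coefficients and exponentials are dominated by `F`
  have hdom : ∀ (i : Fin K × Fin L) (r t : ℕ), r < R → t < S →
      ((r + t * k).choose i.1 : ℝ) * Real.exp (i.2 * w * (r + t * k : ℕ)) ≤ F := by
    intro i r t hr ht
    have hle : ((r + t * k : ℕ) : ℝ) ≤ T := by
      rw [hT]
      have : r + t * k ≤ R + S * k := by gcongr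
      exact_mod_cast this
    refine le_trans ?_ (hF i.1 i.1.2)
    have h1 : ((r + t * k).choose i.1 : ℝ) ≤ (E * T + (i.1 : ℕ)) ^ (i.1 : ℕ) /
        (i.1 : ℕ).factorial := by
      refine (Nat.choose_le_pow_div _ _).trans ?_
      gcongr
      nlinarith [(Nat.cast_nonneg (i.1 : ℕ) : (0 : ℝ) ≤ _)]
    have hl : ((i.2 : ℕ) : ℝ) ≤ L := by exact_mod_cast i.2.2.le
    refine mul_le_mul h1 (Real.exp_le_exp.mpr ?_) (by positivity) (by positivity)
    calc ((i.2 : ℕ) : ℝ) * w * (r + t * k : ℕ) ≤ 1 * (L * w * T) := by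
          rw [one_mul]; gcongr
      _ ≤ E * (L * w * T) := by gcongr
  have hchoose : ∀ (i : Fin K × Fin L) (r t : ℕ), r < R → t < S →
      ((r + t * k).choose i.1 : ℝ) ≤ F := fun i r t hr ht => by
    refine le_trans ?_ (hdom i r t hr ht)
    exact le_mul_of_one_le_right (by positivity) (Real.one_le_exp (by positivity))
  -- all the values vanish
  have hzero : ∀ r < R, ∀ t < S, ∑ i : Fin K × Fin L,
      (p i : ℝ) * (r + t * k).choose i.1 * (x ^ r * ρ ^ t) ^ (i.2 : ℕ) = 0 := by
    intro r hr t ht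
    set ξ := ∑ i : Fin K × Fin L,
      (p i : ℝ) * (r + t * k).choose i.1 * (x ^ r * ρ ^ t) ^ (i.2 : ℕ) with hξ
    have hpow : ∀ l : ℕ, (x ^ r * ρ ^ t) ^ l
        = Real.exp (l * w * (r + t * k : ℕ)) * Real.exp (l * t * lam) := by
      intro l
      rw [hxw, hρw, ← Real.exp_add, ← Real.exp_nat_mul, ← Real.exp_nat_mul, ← Real.exp_add,
        ← Real.exp_nat_mul]
      congr 1
      push_cast
      ring
    have hsmall : |ξ| ≤ (K * L : ℕ) * F * ((12 * m + 1) / (E : ℝ) ^ (5 * m)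
        + 2 * (E : ℝ) ^ m * (L * S * |lam|)) := by
      have hu : ((r + t * k : ℕ) : ℝ) / T ∈ Set.Icc (0 : ℝ) 1 := by
        refine ⟨by positivity, (div_le_one hTpos).mpr ?_⟩
        rw [hT]
        have : r + t * k ≤ R + S * k := by gcongr
        exact_mod_cast this
      have h1 := hp _ hu
      have hTu : T * (((r + t * k : ℕ) : ℝ) / T) = (r + t * k : ℕ) := by field_simp
      have h2 : ξ = ∑ i : Fin K × Fin L, p i * ((scaledBinom T i.1).eval (((r + t * k : ℕ) : ℝ) / T)
            * Real.exp ((i.2 : ℕ) * w * T * (((r + t * k : ℕ) : ℝ) / T)))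
          + ∑ i : Fin K × Fin L, p i * (((r + t * k).choose i.1 *
            Real.exp ((i.2 : ℕ) * w * (r + t * k : ℕ)))
              * (Real.exp ((i.2 : ℕ) * t * lam) - 1)) := by
        rw [hξ, ← Finset.sum_add_distrib]
        refine Finset.sum_congr rfl fun i _ => ?_
        rw [hpow, scaledBinom_eval _ _ _ _ hTu, mul_assoc _ T, hTu]
        ring
      have h3 : |∑ i : Fin K × Fin L, p i * (((r + t * k).choose i.1 *
            Real.exp ((i.2 : ℕ) * w * (r + t * k : ℕ))) * (Real.exp ((i.2 : ℕ) * t * lam) - 1))|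
          ≤ (K * L : ℕ) * ((E : ℝ) ^ m * (F * (2 * (L * S * |lam|)))) := by
        refine (Finset.abs_sum_le_sum_abs _ _).trans ?_
        refine (Finset.sum_le_card_nsmul _ _ ((E : ℝ) ^ m * (F * (2 * (L * S * |lam|))))
          fun i _ => ?_).trans (by simp)
        have hll : |((i.2 : ℕ) : ℝ) * t * lam| ≤ L * S * |lam| := by
          rw [abs_mul, abs_of_nonneg (by positivity : (0 : ℝ) ≤ ((i.2 : ℕ) : ℝ) * t)]
          have hl : ((i.2 : ℕ) : ℝ) ≤ L := by exact_mod_cast i.2.2.le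
          have ht' : (t : ℝ) ≤ S := by exact_mod_cast ht.le
          gcongr
        rw [abs_mul, abs_mul]
        refine mul_le_mul (hpE' i) (mul_le_mul ?_ ?_ (abs_nonneg _) hF0.le) (by positivity)
          (by positivity)
        · rw [abs_of_nonneg (by positivity)]
          exact hdom i r t hr ht
        · refine (Real.abs_exp_sub_one_le (hll.trans hlam)).trans ?_
          linarith
      rw [h2]
      refine (abs_add_le _ _).trans ((add_le_add h1 h3).trans (le_of_eq ?_))
      push_cast
      ring
    by_contra hne
    let q : ℤ[X] := ∑ i : Fin K × Fin L, C (p i * (r + t * k).choose i.1) *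
      (((10 ^ (A * L * R - A * i.2 * r + s * i.2 * t) * 9 ^ (L * S - i.2 * t) * d ^ (i.2 * t) : ℕ)
        : ℤ[X]) * (X ^ (N * i.2 * r + r₀ * i.2 * t) * (3 * X - 2) ^ ((i.2 : ℕ) * t)))
    have hqα : aeval α q = 10 ^ (A * L * R) * 9 ^ (L * S) * ξ := by
      rw [hξ, Finset.mul_sum, map_sum]
      refine Finset.sum_congr rfl fun i _ => ?_
      have := cleared_monomial_real hx hρ (l := i.2) i.2.2.le hr.le ht.le
      simp only [map_mul, map_natCast, map_pow, aeval_X, map_sub, map_ofNat, aeval_C]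
      rw [this]
      simp
      ring
    have hqβ : ‖aeval β q‖ ≤ (K * L : ℕ) * (E : ℝ) ^ m * F
        * (10 ^ (A * L * R) * 10 ^ (s * L * S) * 45 ^ (L * S)) := by
      rw [map_sum]
      refine (norm_sum_le _ _).trans ?_
      refine (Finset.sum_le_card_nsmul _ _ ((E : ℝ) ^ m * F
        * (10 ^ (A * L * R) * 10 ^ (s * L * S) * 45 ^ (L * S))) fun i _ => ?_).trans
        (by simp [mul_assoc])
      have := norm_cleared_monomial_le hβ (A := A) (N := N) (r₀ := r₀) (s := s) (R := R) (r := r)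
        hd (l := i.2) i.2.2.le ht.le
      simp only [map_mul, map_natCast, map_pow, aeval_X, map_sub, map_ofNat, aeval_C]
      rw [norm_mul]
      refine mul_le_mul ?_ this (norm_nonneg _) (by positivity)
      simp only [algebraMap_int_eq, eq_intCast, norm_mul, Complex.norm_intCast,
        Complex.norm_natCast]
      exact mul_le_mul (hpE' i) (hchoose i r t hr ht) (by positivity) (by positivity)
    have hliou := one_le_abs_aeval_mul_norm_aeval_sq hα hadd hmul q (by
      rw [hqα]; positivity)
    rw [hqα, abs_mul, abs_of_nonneg (by positivity)] at hliou
    refine absurd hliou (not_le.mpr (lt_of_le_of_lt ?_ hfin))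
    gcongr
  -- the zero estimate
  have hP := eq_zero_of_sum_eval_mul_pow_eq_zero (K := K) (L := L) (R := R) (S := S) (k := k)
    (x := x) (ρ := ρ) (by rw [hxw]; exact Real.one_lt_exp_iff.mpr hw)
    (by rw [hρw]; positivity) hRk hLR hzc
    (fun l => ∑ i : Fin K, (p (i, l) : ℝ) • scaledBinom 1 i)
    (fun l => by
      rw [← Nat.le_sub_one_iff_lt hKpos]
      refine natDegree_sum_le_of_forall_le _ _ fun i _ => ?_
      refine (natDegree_smul_le _ _).trans ?_
      rw [natDegree_scaledBinom one_ne_zero]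
      omega)
    (by
      intro r hr t ht
      rw [← hzero r hr t ht, Fintype.sum_prod_type_right]
      refine Finset.sum_congr rfl fun l _ => ?_
      rw [eval_finsetSum, Finset.sum_mul]
      refine Finset.sum_congr rfl fun i _ => ?_
      rw [eval_smul, smul_eq_mul, scaledBinom_eval 1 _ i (r + t * k) (by push_cast; ring)])
  apply hp0
  funext ⟨i, l⟩
  have hli := (linearIndependent_scaledBinom one_ne_zero).comp (fun i : Fin K => (i : ℕ))
    Fin.val_injective
  have := Fintype.linearIndependent_iff.mp hli (fun i => (p (i, l) : ℝ)) (hP l) i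
  exact_mod_cast this

theorem pow_div_factorial_le_of_le {Y : ℝ} {i K : ℕ} (hi : i ≤ K) (hK : 0 < K) (hY : K ≤ Y) :
    Y ^ i / i.factorial ≤ (Y / K) ^ K * Real.exp K := by
  have hK' : (0 : ℝ) < K := by exact_mod_cast hK
  have h1 : 1 ≤ Y / K := (one_le_div hK').mpr hY
  calc Y ^ i / i.factorial = (Y / K) ^ i * ((K : ℝ) ^ i / i.factorial) := by
        rw [div_pow]; field_simp
    _ ≤ (Y / K) ^ K * Real.exp K := by
        refine mul_le_mul (pow_le_pow_right₀ h1 hi) (Real.pow_div_factorial_le_exp _ hK'.le _)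
          (by positivity) (by positivity)

set_option maxHeartbeats 1000000 in
/-- Instantiation of the parameters of `interpolation_contradiction`. -/
theorem linear_form_contradiction {α : ℝ} {β : ℂ} (hα : α ^ 3 = α ^ 2 + 1)
    (hadd : β + starRingEnd ℂ β = 1 - α) (hmul : β * starRingEnd ℂ β = α ^ 2 - α)
    (hβ : ‖β‖ ≤ 1) {x ρ w lam : ℝ} {A N r₀ s d k m₁ : ℕ}
    (hx : x = α ^ N / 10 ^ A) (hρ : ρ = 10 ^ s * (d * (3 * α - 2) * α ^ r₀) / 9) (hd : d ≤ 9)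
    (hw : 0 < w) (hw' : w ≤ 14 / 10 ^ 17) (hxw : x = Real.exp w)
    (hρw : ρ = Real.exp (k * w + lam)) (hA : 0 < A) (hk : 10 ^ 29 ≤ k) (hs : s ≤ k * w + 3)
    (hm₁ : A * k ≤ 2 * m₁) (hlam : |lam| ≤ 54 / 10 ^ m₁) : False := by
  obtain ⟨g, hg⟩ : ∃ g, g = k / 10 ^ 4 := ⟨_, rfl⟩
  have hgk : 10 ^ 4 * g ≤ k := by omega
  have hkg : k ≤ 10001 * g := by omega
  have hg25 : 10 ^ 25 ≤ g := by omega
  obtain ⟨y, hy⟩ : ∃ y, y = 12 * A * g := ⟨_, rfl⟩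
  have hAg : g ≤ A * g := Nat.le_mul_of_pos_left _ hA
  have hgy : 12 * g ≤ y := by rw [hy]; nlinarith
  have hAy : 10 ^ 25 * A ≤ y := by rw [hy]; nlinarith
  have hy0 : 0 < y := by omega
  have hyR : (0 : ℝ) < y := by exact_mod_cast hy0
  have hkR : (k : ℝ) ≤ 10001 * g := by exact_mod_cast hkg
  have hg25R : (10 : ℝ) ^ 25 ≤ g := by exact_mod_cast hg25
  have hyAg : (y : ℝ) = 12 * A * g := by rw [hy]; push_cast; ring
  have hAyR : (10 : ℝ) ^ 25 * A ≤ y := by exact_mod_cast hAy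
  have hgyR : (12 : ℝ) * g ≤ y := by exact_mod_cast hgy
  -- the time span
  obtain ⟨T, hT⟩ : ∃ T : ℝ, T = ((g + 360 : ℕ) : ℝ) + (360 * (12 * A) : ℕ) * k := ⟨_, rfl⟩
  have hT0 : 0 ≤ T := by rw [hT]; positivity
  have hTy : T ≤ 3700000 * y := by
    have h1 : (A : ℝ) * k ≤ A * (10001 * g) := by gcongr
    rw [hT]
    push_cast
    nlinarith
  have hpow_y : ∀ {a b : ℕ}, a ≤ b → (10 : ℝ) ^ a ≤ 10 ^ b := fun h =>
    pow_le_pow_right₀ (by norm_num) h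
  have hexp : Real.exp y ≤ (2.72 : ℝ) ^ y := by
    rw [← mul_one (y : ℝ), Real.exp_nat_mul]
    gcongr
    linarith [Real.exp_one_lt_d9]
  have hlin : 400 * (y : ℝ) + 400 ≤ 10 ^ y := by
    have h1 : (y + 1 : ℝ) ≤ 2 ^ y := by exact_mod_cast Nat.lt_two_pow_self
    have h2 : (5 : ℝ) ^ 4 ≤ 5 ^ y := pow_le_pow_right₀ (by norm_num) (by omega)
    rw [show (10 : ℝ) = 2 * 5 by norm_num, mul_pow]
    nlinarith
  have hlam' : ((360 : ℕ) : ℝ) * ((360 * (12 * A) : ℕ) : ℝ) * |lam| ≤ 1 / 10 ^ (331 * y) := by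
    have h1 : 10000 * y ≤ 24 * m₁ := by rw [hy]; nlinarith
    have h2 : (10 : ℝ) ^ (331 * y) * 10 ^ y ≤ 10 ^ m₁ := by
      rw [← pow_add]; exact hpow_y (by omega)
    calc _ ≤ ((360 : ℕ) : ℝ) * ((360 * (12 * A) : ℕ) : ℝ) * (54 / (10 ^ (331 * y) * 10 ^ y)) := by
          gcongr
          exact hlam.trans (by gcongr)
      _ = (83980800 * A) / 10 ^ y * (1 / 10 ^ (331 * y)) := by push_cast; field_simp; norm_num
      _ ≤ 1 * (1 / 10 ^ (331 * y)) := by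
          gcongr
          rw [div_le_one (by positivity)]
          linarith
      _ = _ := one_mul _
  have hsy : s * 129600 ≤ g := by
    have : (s : ℝ) * 129600 ≤ g := by
      have : (k : ℝ) * w ≤ 10001 * g * (14 / 10 ^ 17) := by gcongr
      nlinarith
    exact_mod_cast this
  have hmain := interpolation_contradiction hα hadd hmul hβ (L := 360) (S := 360 * (12 * A))
    (R := g + 360) (K := y + 1) (m := 10 * y) (E := 10 ^ 6) (F := 10 ^ (15 * y)) (w := w)
    (lam := lam) hx hρ hd hw hxw hρw
  refine hmain (by omega) (by omega) ?_ (by omega) (by omega) (by norm_num) ?_ ?_ ?_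
  · rw [hy, Nat.add_sub_cancel, Nat.add_sub_cancel]
    have : (g + 1) * (360 * (12 * A)) = 360 * (12 * A * g) + 360 * (12 * A) := by ring
    omega
  · intro i hi
    rw [← hT]
    have hexp2 : Real.exp (((10 ^ 6 : ℕ) : ℝ) * ((360 : ℕ) * w * T)) ≤ 10 ^ y := by
      calc _ ≤ Real.exp y := by
            rw [Real.exp_le_exp]
            push_cast
            have : w * T ≤ 14 / 10 ^ 17 * (3700000 * y) := by gcongr
            nlinarith
        _ ≤ (2.72 : ℝ) ^ y := hexp
        _ ≤ 10 ^ y := by gcongr; norm_num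
    have hi' : i ≤ y := by omega
    have h1 : (((10 ^ 6 : ℕ) : ℝ) * T + i) ^ i / i.factorial ≤ 10 ^ (14 * y) := by
      have hi'' : (i : ℝ) ≤ y := by exact_mod_cast hi'
      calc _ ≤ (3800000000000 * (y : ℝ)) ^ i / i.factorial := by
            gcongr
            push_cast
            linarith
        _ ≤ (3800000000000 * (y : ℝ) / y) ^ y * Real.exp y :=
            pow_div_factorial_le_of_le hi' hy0 (by linarith)
        _ ≤ 3800000000000 ^ y * (2.72 : ℝ) ^ y := by
            rw [mul_div_cancel_right₀ _ hyR.ne']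
            gcongr
        _ = (3800000000000 * 2.72) ^ y := by rw [mul_pow]
        _ ≤ (10 ^ 14) ^ y := by gcongr; norm_num
        _ = _ := by rw [← pow_mul]
    calc _ ≤ (10 : ℝ) ^ (14 * y) * 10 ^ y := by gcongr
      _ = _ := by rw [← pow_add]; congr 1; ring
  · refine hlam'.trans ?_
    rw [div_le_one (by positivity)]
    exact one_le_pow₀ (by norm_num)
  · have b1 : (10 : ℝ) ^ (A * 360 * (g + 360)) ≤ 10 ^ (31 * y) := by
      refine hpow_y ?_
      rw [hy]
      nlinarith
    have hLS : 2 * (360 * (360 * (12 * A))) ≤ y := by omega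
    have b2 : (9 : ℝ) ^ (360 * (360 * (12 * A))) ≤ 10 ^ y := by
      refine le_trans ?_ (hpow_y hLS)
      calc (9 : ℝ) ^ (360 * (360 * (12 * A))) ≤ 10 ^ (360 * (360 * (12 * A))) := by
            gcongr; norm_num
        _ ≤ _ := hpow_y (by omega)
    have b3 : (45 : ℝ) ^ (360 * (360 * (12 * A))) ≤ 10 ^ y := by
      refine le_trans ?_ (hpow_y hLS)
      rw [pow_mul (10 : ℝ) 2]
      gcongr
      norm_num
    have b4 : (10 : ℝ) ^ (s * 360 * (360 * (12 * A))) ≤ 10 ^ y := by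
      refine hpow_y ?_
      rw [hy]
      calc s * 360 * (360 * (12 * A)) = 12 * A * (s * 129600) := by ring
        _ ≤ 12 * A * g := by gcongr
    have b5 : (((y + 1) * 360 : ℕ) : ℝ) ≤ 10 ^ y := by push_cast; linarith
    have b6 : (((10 ^ 6 : ℕ) : ℝ)) ^ (10 * y) = 10 ^ (60 * y) := by
      rw [Nat.cast_pow, Nat.cast_ofNat, ← pow_mul]; congr 1; ring
    have b7 : (((10 ^ 6 : ℕ) : ℝ)) ^ (5 * (10 * y)) = 10 ^ (300 * y) := by
      rw [Nat.cast_pow, Nat.cast_ofNat, ← pow_mul]; congr 1; ring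
    have b8 : 12 * ((10 * y : ℕ) : ℝ) + 1 ≤ 10 ^ y := by push_cast; linarith
    rw [b6, b7]
    calc _ ≤ (10 : ℝ) ^ (31 * y) * 10 ^ y * (10 ^ y * 10 ^ (15 * y) * (10 ^ y / 10 ^ (300 * y)
          + 2 * 10 ^ (60 * y) * (1 / 10 ^ (331 * y))))
          * (10 ^ y * 10 ^ (60 * y) * 10 ^ (15 * y) * (10 ^ (31 * y) * 10 ^ y * 10 ^ y)) ^ 2 := by
          gcongr
      _ = (1 / 10 ^ y) ^ 33 + 2 * (1 / 10 ^ y) ^ 5 := by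
          simp only [mul_comm _ y, pow_mul]
          field_simp
      _ < 1 := by
          have h1 : 1 / (10 : ℝ) ^ y ≤ 1 / 10 := by
            gcongr
            linarith
          have h0 : 0 ≤ 1 / (10 : ℝ) ^ y := by positivity
          have h5 : (1 / (10 : ℝ) ^ y) ^ 5 ≤ (1 / 10) ^ 5 := by gcongr
          have h33 : (1 / (10 : ℝ) ^ y) ^ 33 ≤ (1 / 10) ^ 33 := by gcongr
          norm_num at h5 h33 ⊢
          linarith

theorem abs_log_sub_log_le {c c₀ ε : ℝ} (hc : 1 / 2 ≤ c) (hc₀ : 1 / 2 ≤ c₀) (h : |c - c₀| ≤ ε) :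
    |Real.log c - Real.log c₀| ≤ 2 * ε := by
  have key : ∀ x y : ℝ, 1 / 2 ≤ x → 1 / 2 ≤ y → Real.log x - Real.log y ≤ 2 * |x - y| := by
    intro x y hx hy
    rw [← Real.log_div (by linarith) (by linarith)]
    refine (Real.log_le_sub_one_of_pos (by positivity)).trans ?_
    rw [div_sub_one (by linarith), div_le_iff₀ (by linarith)]
    nlinarith [le_abs_self (x - y), abs_nonneg (x - y)]
  rw [abs_le]
  have h1 := key c c₀ hc hc₀
  have h2 := key c₀ c hc₀ hc
  rw [abs_sub_comm] at h2
  constructor <;> linarith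

theorem log_kleisma : |6 * Real.log 5 - 6 * Real.log 2 - 5 * Real.log 3 - 46829479043819341249370859954379054631545303358275480783356236972407283347334597775445325119050956 / 10 ^ 100| ≤ 1 / 10 ^ 99 := by
  have h := Real.abs_log_sub_add_sum_range_le (x := 1 - 15625 / 15552) (by norm_num [abs_lt]) 42
  have e : Real.log (15625 / 15552) = 6 * Real.log 5 - 6 * Real.log 2 - 5 * Real.log 3 := by
    rw [show (15625 / 15552 : ℝ) = 5 ^ 6 / (2 ^ 6 * 3 ^ 5) by norm_num, Real.log_div (by positivity) (by positivity),
      Real.log_mul (by positivity) (by positivity)]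
    simp only [Real.log_pow]
    push_cast
    ring
  rw [sub_sub_cancel, e] at h
  norm_num [Finset.sum_range_succ, abs_le] at h ⊢
  constructor <;> linarith [h.1, h.2]

theorem log_schisma : |8 * Real.log 3 + Real.log 5 - 15 * Real.log 2 - 11285133797982645042394067337447555730238014466845239800024181732290039111087655311100116567560079 / 10 ^ 100| ≤ 1 / 10 ^ 99 := by
  have h := Real.abs_log_sub_add_sum_range_le (x := 1 - 32805 / 32768) (by norm_num [abs_lt]) 33
  have e : Real.log (32805 / 32768) = 8 * Real.log 3 + Real.log 5 - 15 * Real.log 2 := by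
    rw [show (32805 / 32768 : ℝ) = 3 ^ 8 * 5 / 2 ^ 15 by norm_num, Real.log_div (by positivity) (by positivity),
      Real.log_mul (by positivity) (by positivity)]
    simp only [Real.log_pow]
    push_cast
    ring
  rw [sub_sub_cancel, e] at h
  norm_num [Finset.sum_range_succ, abs_le] at h ⊢
  constructor <;> linarith [h.1, h.2]

theorem log_medium_semicomma : |2 * Real.log 2 + 9 * Real.log 3 - 7 * Real.log 5 - 77395720941752191863560426357710012992058092456315204650737814049829689532657806633313006641688985 / 10 ^ 100| ≤ 1 / 10 ^ 99 := by
  have h := Real.abs_log_sub_add_sum_range_le (x := 1 - 78732 / 78125) (by norm_num [abs_lt]) 47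
  have e : Real.log (78732 / 78125) = 2 * Real.log 2 + 9 * Real.log 3 - 7 * Real.log 5 := by
    rw [show (78732 / 78125 : ℝ) = 2 ^ 2 * 3 ^ 9 / 5 ^ 7 by norm_num, Real.log_div (by positivity) (by positivity),
      Real.log_mul (by positivity) (by positivity)]
    simp only [Real.log_pow]
    push_cast
    ring
  rw [sub_sub_cancel, e] at h
  norm_num [Finset.sum_range_succ, abs_le] at h ⊢
  constructor <;> linarith [h.1, h.2]

theorem log_breedsma :
    |4 * Real.log 7 - 5 * Real.log 2 - Real.log 3 - 2 * Real.log 5 - 416579885216232738486463106935094472144980166383587674170 / 10 ^ 60|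
      ≤ 1 / 10 ^ 59 := by
  have h := Real.abs_log_sub_add_sum_range_le (x := 1 - 2401 / 2400) (by norm_num [abs_lt]) 18
  have e : Real.log (2401 / 2400)
      = 4 * Real.log 7 - 5 * Real.log 2 - Real.log 3 - 2 * Real.log 5 := by
    rw [show (2401 / 2400 : ℝ) = 7 ^ 4 / (2 ^ 5 * (3 * 5 ^ 2)) by norm_num,
      Real.log_div (by positivity) (by positivity), Real.log_mul (by positivity) (by positivity),
      Real.log_mul (by positivity) (by positivity)]
    simp only [Real.log_pow]
    push_cast
    ring
  rw [sub_sub_cancel, e] at h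
  norm_num [Finset.sum_range_succ, abs_le] at h ⊢
  constructor <;> linarith [h.1, h.2]

theorem log_two_three_five :
    |Real.log 2 - 6931471805599453094172321214581765680755001343602552541206800094933936219696947156058633269964186875 / 10 ^ 100| ≤ 1 / 10 ^ 96 ∧
    |Real.log 3 - 10986122886681096913952452369225257046474905578227494517346943336374942932186089668736157548137320887 / 10 ^ 100| ≤ 1 / 10 ^ 96 ∧
    |Real.log 5 - 16094379124341003746007593332261876395256013542685177219126478914741789877076577646301338780931796107 / 10 ^ 100| ≤ 1 / 10 ^ 96 := by
  have h1 := log_kleisma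
  have h2 := log_schisma
  have h3 := log_medium_semicomma
  simp only [abs_le] at h1 h2 h3 ⊢
  norm_num at h1 h2 h3 ⊢
  refine ⟨⟨?_, ?_⟩, ⟨?_, ?_⟩, ?_, ?_⟩ <;> linarith [h1.1, h1.2, h2.1, h2.2, h3.1, h3.2]

theorem narayana_ratio_bounds {α : ℝ} (h0 : 1 < α) (hα : α ^ 3 = α ^ 2 + 1) :
    14655712318767680266567312252199391080255775684722857016431831112492629966850178404781258011949092700 / 10 ^ 100 < α ∧ α < 14655712318767680266567312252199391080255775684722857016431831112492629966850178404781258011949092701 / 10 ^ 100 := by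
  constructor
  · by_contra! h
    have h2 : α ^ 2 * (α - 1) ≤ (14655712318767680266567312252199391080255775684722857016431831112492629966850178404781258011949092700 / 10 ^ 100) ^ 2 * (14655712318767680266567312252199391080255775684722857016431831112492629966850178404781258011949092700 / 10 ^ 100 - 1) := by
      gcongr
    norm_num at h2
    nlinarith
  · by_contra! h
    have h2 : (14655712318767680266567312252199391080255775684722857016431831112492629966850178404781258011949092701 / 10 ^ 100) ^ 2 * (14655712318767680266567312252199391080255775684722857016431831112492629966850178404781258011949092701 / 10 ^ 100 - 1) ≤ α ^ 2 * (α - 1) := by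
      gcongr
    norm_num at h2
    nlinarith

theorem log_near_root_pow : |Real.log (10000048253867158208835256521438343034047553680525640161690694512454251672133454378746126296419463434 / 10 ^ 100) - 48253750736798567887022099518777093327631487703488864989053774068967861346894816980693563494529 / 10 ^ 100| ≤ 1 / 10 ^ 99 := by
  have h := Real.abs_log_sub_add_sum_range_le (x := 1 - 10000048253867158208835256521438343034047553680525640161690694512454251672133454378746126296419463434 / 10 ^ 100) (by norm_num [abs_lt]) 19
  rw [sub_sub_cancel] at h
  norm_num [Finset.sum_range_succ, abs_le] at h ⊢
  constructor <;> linarith [h.1, h.2]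

theorem log_near_deriv : |Real.log (999816205032544618305265397582455201795124617508809210379668 / 10 ^ 60) - -183811859820265464847167988454577187269029839014082336951 / 10 ^ 60| ≤ 1 / 10 ^ 59 := by
  have h := Real.abs_log_sub_add_sum_range_le (x := 1 - 999816205032544618305265397582455201795124617508809210379668 / 10 ^ 60) (by norm_num [abs_lt]) 16
  rw [sub_sub_cancel] at h
  norm_num [Finset.sum_range_succ, abs_le] at h ⊢
  constructor <;> linarith [h.1, h.2]

theorem log_narayana_ratio {α : ℝ} (h0 : 1 < α) (hα : α ^ 3 = α ^ 2 + 1) :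
    |Real.log α - 3822450858400356413293584991848573937594164224201954300292839383616548905505831820170135085159009126 / 10 ^ 100| ≤ 1 / 10 ^ 94 := by
  obtain ⟨hl, hu⟩ := narayana_ratio_bounds h0 hα
  have hα0 : 0 < α := by linarith
  have hlo : (14655712318767680266567312252199391080255775684722857016431831112492629966850178404781258011949092700 / 10 ^ 100) ^ 12 ≤ α ^ 12 := by gcongr
  have hhi : α ^ 12 ≤ (14655712318767680266567312252199391080255775684722857016431831112492629966850178404781258011949092701 / 10 ^ 100) ^ 12 := by gcongr
  have hc : |α ^ 12 * (3 ^ 7 * 5 ^ 4) / 2 ^ 27 - 10000048253867158208835256521438343034047553680525640161690694512454251672133454378746126296419463434 / 10 ^ 100| ≤ 1 / 10 ^ 97 := by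
    rw [abs_le]
    norm_num at hlo hhi ⊢
    constructor <;> linarith
  have h := abs_log_sub_log_le (by norm_num [abs_le] at hc ⊢; linarith [hc.1]) (by norm_num) hc
  rw [Real.log_div (by positivity) (by positivity), Real.log_mul (by positivity) (by positivity),
    Real.log_mul (by positivity) (by positivity)] at h
  simp only [Real.log_pow] at h
  have h' := log_near_root_pow
  obtain ⟨h2, h3, h5⟩ := log_two_three_five
  simp only [abs_le] at h h' h2 h3 h5 ⊢
  norm_num at h h' h2 h3 h5 ⊢
  constructor <;> linarith [h.1, h.2, h'.1, h'.2, h2.1, h2.2, h3.1, h3.2, h5.1, h5.2]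

theorem log_three_mul_narayana_ratio_sub_two {α : ℝ} (h0 : 1 < α) (hα : α ^ 3 = α ^ 2 + 1) :
    |Real.log (3 * α - 2) - 874098505527527220338274184800354948219132611756423698064845 / 10 ^ 60| ≤ 1 / 10 ^ 54 := by
  obtain ⟨hl, hu⟩ := narayana_ratio_bounds h0 hα
  have hα0 : 0 < α := by linarith
  have hk0 : 0 < 3 * α - 2 := by linarith
  have hlo : (14655712318767680266567312252199391080255775684722857016431831112492629966850178404781258011949092700 / 10 ^ 100) ^ 4 * (3 * (14655712318767680266567312252199391080255775684722857016431831112492629966850178404781258011949092700 / 10 ^ 100) - 2) ≤ α ^ 4 * (3 * α - 2) := by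
    gcongr
  have hhi : α ^ 4 * (3 * α - 2) ≤ (14655712318767680266567312252199391080255775684722857016431831112492629966850178404781258011949092701 / 10 ^ 100) ^ 4 * (3 * (14655712318767680266567312252199391080255775684722857016431831112492629966850178404781258011949092701 / 10 ^ 100) - 2) := by
    gcongr
  have hc : |α ^ 4 * (3 * α - 2) * 5 ^ 4 / (2 ^ 8 * 3 ^ 3) - 999816205032544618305265397582455201795124617508809210379668 / 10 ^ 60|
      ≤ 1 / 10 ^ 57 := by
    rw [abs_le]
    norm_num at hlo hhi ⊢
    constructor <;> linarith
  have h := abs_log_sub_log_le (by norm_num [abs_le] at hc ⊢; linarith [hc.1]) (by norm_num) hc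
  rw [Real.log_div (by positivity) (by positivity), Real.log_mul (by positivity) (by positivity),
    Real.log_mul (by positivity) (by positivity), Real.log_mul (by positivity) (by positivity)] at h
  simp only [Real.log_pow] at h
  have h' := log_near_deriv
  obtain ⟨h2, h3, h5⟩ := log_two_three_five
  have h4 := log_narayana_ratio h0 hα
  simp only [abs_le] at h h' h2 h3 h4 h5 ⊢
  norm_num at h h' h2 h3 h4 h5 ⊢
  constructor <;>
    linarith [h.1, h.2, h'.1, h'.2, h2.1, h2.2, h3.1, h3.2, h4.1, h4.2, h5.1, h5.2]

theorem log_seven_bounds : |Real.log 7 - 1945910149055313305105352743443179729637084729581861188459390 / 10 ^ 60| ≤ 1 / 10 ^ 54 := by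
  have h := log_breedsma
  obtain ⟨h2, h3, h5⟩ := log_two_three_five
  simp only [abs_le] at h h2 h3 h5 ⊢
  norm_num at h h2 h3 h5 ⊢
  constructor <;> linarith [h.1, h.2, h2.1, h2.2, h3.1, h3.2, h5.1, h5.2]

/-- The inhomogeneous Baker–Davenport step. -/
theorem le_mul_abs_of_far_from_int {x y κ Λ ε η : ℝ} {n a p q : ℕ} {j : ℤ} (hy : 0 ≤ y)
    (hΛ : Λ = n * x - a * y - κ) (hη : n * |q * x - p * y| ≤ η) (h1 : j * y + ε ≤ q * κ)
    (h2 : q * κ ≤ (j + 1) * y - ε) : ε - η ≤ q * |Λ| := by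
  have hkey : q * Λ = n * (q * x - p * y) + ((n * p - a * q : ℤ) : ℝ) * y - q * κ := by
    rw [hΛ]; push_cast; ring
  have hη' : |n * (q * x - p * y)| ≤ η := by rwa [abs_mul, Nat.abs_cast]
  obtain ⟨hl, hu⟩ := abs_le.mp hη'
  rw [← Nat.abs_cast q, ← abs_mul, hkey]
  rcases le_or_gt (n * p - a * q : ℤ) j with hj | hj
  · have : ((n * p - a * q : ℤ) : ℝ) ≤ j := by exact_mod_cast hj
    have := mul_le_mul_of_nonneg_right this hy
    refine le_trans ?_ (neg_le_abs _)
    linarith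
  · have : ((j + 1 : ℤ) : ℝ) ≤ (n * p - a * q : ℤ) := by exact_mod_cast hj
    push_cast at this
    have := mul_le_mul_of_nonneg_right this hy
    refine le_trans ?_ (le_abs_self _)
    push_cast
    linarith

theorem log_ten_eq : Real.log 10 = Real.log 2 + Real.log 5 := by
  rw [show (10 : ℝ) = 2 * 5 by norm_num, Real.log_mul (by norm_num) (by norm_num)]

theorem log_digit (d : ℕ) (h1 : 1 ≤ d) (hd : d ≤ 9) :
    Real.log d = if d = 1 then 0 else if d = 2 then Real.log 2 else if d = 3 then Real.log 3 else
      if d = 4 then 2 * Real.log 2 else if d = 5 then Real.log 5 else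
      if d = 6 then Real.log 2 + Real.log 3 else if d = 7 then Real.log 7 else
      if d = 8 then 3 * Real.log 2 else 2 * Real.log 3 := by
  have h4 : Real.log 4 = 2 * Real.log 2 := by
    rw [show (4 : ℝ) = 2 ^ 2 by norm_num, Real.log_pow]; norm_num
  have h6 : Real.log 6 = Real.log 2 + Real.log 3 := by
    rw [show (6 : ℝ) = 2 * 3 by norm_num, Real.log_mul (by norm_num) (by norm_num)]
  have h8 : Real.log 8 = 3 * Real.log 2 := by
    rw [show (8 : ℝ) = 2 ^ 3 by norm_num, Real.log_pow]; norm_num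
  have h9 : Real.log 9 = 2 * Real.log 3 := by
    rw [show (9 : ℝ) = 3 ^ 2 by norm_num, Real.log_pow]; norm_num
  interval_cases d <;> simp [h4, h6, h8, h9]

theorem digit_constant_far_from_int {α : ℝ} (h0 : 1 < α) (hα : α ^ 3 = α ^ 2 + 1) (d : ℕ)
    (h1 : 1 ≤ d) (h9 : d ≤ 9) : ∃ j : ℤ,
      j * Real.log 10 + 1 / 20 ≤
        (1116302941007480981701090839452112970644676382 : ℕ) * (Real.log d + Real.log (3 * α - 2) - 2 * Real.log 3) ∧
      (1116302941007480981701090839452112970644676382 : ℕ) * (Real.log d + Real.log (3 * α - 2) - 2 * Real.log 3)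
        ≤ (j + 1) * Real.log 10 - 1 / 20 := by
  refine ⟨if d = 1 then -641457086549260470880112983438610778639109329 else
      if d = 2 then -305416417058089015005279433585492052687972731 else
      if d = 3 then -108845226688521826224685954346190734757181855 else
      if d = 4 then 30624252433082440869554116267626673263163866 else
      if d = 5 then 138805184967049054946144306160383466054430456 else
      if d = 6 then 227195442802649629650147595506927991193954742 else
      if d = 7 then 301928340958312274146247540028974510150418080 else
      if d = 8 then 366664921924253896744387666120745399214300463 else 423766633172216818430741074746229309124745619, ?_⟩
  have hk := log_three_mul_narayana_ratio_sub_two h0 hα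
  have h7 := log_seven_bounds
  obtain ⟨h2, h3, h5⟩ := log_two_three_five
  rw [log_digit d h1 h9, log_ten_eq]
  simp only [abs_le] at hk h2 h3 h5 h7
  norm_num at hk h2 h3 h5 h7
  interval_cases d <;> norm_num <;> constructor <;>
    linarith [hk.1, hk.2, h2.1, h2.2, h3.1, h3.2, h5.1, h5.2, h7.1, h7.2]

theorem exponent_le_of_linear_form_small {α : ℝ} (h0 : 1 < α) (hα : α ^ 3 = α ^ 2 + 1)
    {n a d m : ℕ} (h1 : 1 ≤ d) (h9 : d ≤ 9) (hn : n ≤ 4 * 10 ^ 42)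
    (hΛ : |n * Real.log α - a * Real.log 10
      - (Real.log d + Real.log (3 * α - 2) - 2 * Real.log 3)| ≤ 36 / 10 ^ m) : m ≤ 48 := by
  by_contra! hm
  obtain ⟨j, hj1, hj2⟩ := digit_constant_far_from_int h0 hα d h1 h9
  have hη : (n : ℝ) * |(1116302941007480981701090839452112970644676382 : ℕ) * Real.log α
      - (185314025877779896110558054431249627797797533 : ℕ) * Real.log 10| ≤ 1 / 125 := by
    have hl := log_narayana_ratio h0 hα
    obtain ⟨h2, h3, h5⟩ := log_two_three_five
    have : |(1116302941007480981701090839452112970644676382 : ℕ) * Real.log α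
        - (185314025877779896110558054431249627797797533 : ℕ) * Real.log 10| ≤ 2 / 10 ^ 45 := by
      rw [log_ten_eq]
      simp only [abs_le] at hl h2 h5 ⊢
      norm_num at hl h2 h5 ⊢
      constructor <;> linarith [hl.1, hl.2, h2.1, h2.2, h5.1, h5.2]
    have hn' : (n : ℝ) ≤ 4 * 10 ^ 42 := by exact_mod_cast hn
    calc _ ≤ (4 * 10 ^ 42 : ℝ) * (2 / 10 ^ 45) := by gcongr
      _ = 1 / 125 := by norm_num
  have h := le_mul_abs_of_far_from_int (a := a) (Real.log_nonneg (by norm_num)) rfl hη hj1 hj2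
  have hm' : (10 : ℝ) ^ 49 ≤ 10 ^ m := pow_le_pow_right₀ (by norm_num) hm
  have h' : |n * Real.log α - a * Real.log 10
      - (Real.log d + Real.log (3 * α - 2) - 2 * Real.log 3)| ≤ 36 / 10 ^ 49 :=
    hΛ.trans (by gcongr)
  norm_num at h h'
  linarith

/-- `9 x` is not close to a one-digit multiple of `10 ^ a`. -/
def farFromDigit (x a : ℕ) : Bool :=
  decide (18 * x < 10 ^ a) || decide (2 * 10 ^ (a + 1) < 9 * x) ||
    (List.range 9).all fun d => decide (81 * (10 : ℤ) ^ a < (9 * x - (d + 1) * 10 ^ a) ^ 2)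

def farFromDigits : ℕ → ℕ → ℕ → ℕ → Bool
  | 0, _, _, _ => true
  | k + 1, x, y, z => (List.range 97).all (farFromDigit x) && farFromDigits k y z (z + x)

theorem farFromDigit_of_farFromDigits {k n : ℕ}
    (h : farFromDigits k (narayana n) (narayana (n + 1)) (narayana (n + 2)) = true) {i a : ℕ}
    (hi : i < k) (ha : a ≤ 96) : farFromDigit (narayana (n + i)) a = true := by
  induction k generalizing n i with
  | zero => omega
  | succ k ih =>
    rw [farFromDigits, Bool.and_eq_true, List.all_eq_true] at h
    cases i with
    | zero => exact h.1 a (List.mem_range.mpr (by omega))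
    | succ i =>
      have := ih (n := n + 1) (i := i) h.2 (by omega)
      rwa [Nat.add_right_comm, Nat.add_assoc] at this

theorem farFromDigit_narayana {n a : ℕ} (hn : 250 < n) (hn' : n ≤ 650) (ha : a ≤ 96) :
    farFromDigit (narayana n) a = true := by
  have h1 : narayana 251 = 194143856681738648918154039368001020253496 := by decide +kernel
  have h2 : narayana 252 = 284531651198362413025631072051583154623872 := by decide +kernel
  have h3 : narayana 253 = 417001402554714881184674132024920564937793 := by decide +kernel
  obtain ⟨i, rfl⟩ := Nat.exists_eq_add_of_le (Nat.succ_le_of_lt hn)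
  refine farFromDigit_of_farFromDigits (k := 400) (n := 251) ?_ (by omega) ha
  rw [h1, h2, h3]
  decide +kernel

theorem narayana_ne_of_le {n : ℕ} (hn : 250 < n) (hn' : n ≤ 650) {d a b : ℕ} (h1 : 1 ≤ d)
    (h9 : d ≤ 9) (ha : a ≤ 96) (hab : 2 * b ≤ a)
    (hab' : b + 2 ≤ a) (h : |(9 * narayana n - d * 10 ^ a : ℤ)| ≤ 9 * 10 ^ b) : False := by
  have hf := farFromDigit_narayana hn hn' ha
  have hba : (10 : ℤ) ^ (b + 2) ≤ 10 ^ a := pow_le_pow_right₀ (by norm_num) hab'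
  rw [pow_add] at hba
  have hda : (d : ℤ) * 10 ^ a ≤ 9 * 10 ^ a := by gcongr; exact_mod_cast h9
  have hda' : 1 * (10 : ℤ) ^ a ≤ d * 10 ^ a := by gcongr; exact_mod_cast h1
  have ha0 : (0 : ℤ) < 10 ^ a := by positivity
  obtain ⟨hl, hu⟩ := abs_le.mp h
  simp only [farFromDigit, Bool.or_eq_true, decide_eq_true_eq, List.all_eq_true,
    List.mem_range] at hf
  rcases hf with (hf | hf) | hf
  · have : (18 * narayana n : ℤ) < 10 ^ a := by exact_mod_cast hf
    linarith
  · have : (2 * 10 ^ (a + 1) : ℤ) < 9 * narayana n := by exact_mod_cast hf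
    rw [pow_succ] at this
    linarith
  · have hfd := hf (d - 1) (by omega)
    have hd : ((d - 1 : ℕ) : ℤ) + 1 = d := by omega
    rw [hd] at hfd
    have hsq : (9 * narayana n - d * 10 ^ a : ℤ) ^ 2 ≤ (9 * 10 ^ b) ^ 2 :=
      sq_le_sq' hl hu
    have hb : (10 : ℤ) ^ (2 * b) ≤ 10 ^ a := pow_le_pow_right₀ (by norm_num) hab
    rw [mul_pow, ← pow_mul, mul_comm b 2] at hsq
    linarith

theorem exists_narayana_ratio : ∃ α : ℝ, 1 < α ∧ α ^ 3 = α ^ 2 + 1 := by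
  have hc : ContinuousOn (fun x : ℝ => x ^ 3 - x ^ 2) (Set.Icc 1 2) := by fun_prop
  obtain ⟨α, ⟨h1, -⟩, h⟩ := intermediate_value_Icc (by norm_num) hc
    (show (1 : ℝ) ∈ Set.Icc _ _ by norm_num)
  refine ⟨α, lt_of_le_of_ne h1 ?_, by simp only at h; linarith⟩
  rintro rfl
  norm_num at h

theorem exists_conjugate_narayana_ratio {α : ℝ} (h0 : 1 < α) (hα : α ^ 3 = α ^ 2 + 1) :
    ∃ β : ℂ, β + starRingEnd ℂ β = 1 - α ∧ β * starRingEnd ℂ β = α ^ 2 - α ∧ ‖β‖ ≤ 1 := by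
  have hdisc : 0 ≤ 4 * (α ^ 2 - α) - (1 - α) ^ 2 := by nlinarith
  have hsq := Real.sq_sqrt hdisc
  set r := √(4 * (α ^ 2 - α) - (1 - α) ^ 2)
  have hns : Complex.normSq ⟨(1 - α) / 2, r / 2⟩ = α ^ 2 - α := by
    rw [Complex.normSq_mk]
    linarith
  refine ⟨⟨(1 - α) / 2, r / 2⟩, ?_, ?_, ?_⟩
  · rw [Complex.add_conj]
    push_cast
    ring
  · rw [Complex.mul_conj, hns]
    push_cast
    ring
  · rw [← sq_le_one_iff₀ (norm_nonneg _), ← Complex.normSq_eq_norm_sq, hns]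
    nlinarith [sq_nonneg (α - 1)]

/-- An elementary form of the Binet formula for the Narayana sequence. -/
theorem abs_mul_narayana_sub_pow_le {α : ℝ} (h0 : 1 < α) (hα : α ^ 3 = α ^ 2 + 1) (n : ℕ) :
    |(3 * α - 2) * narayana n - α ^ n| ≤ 3 * α - 2 := by
  have hα' : α < 3 / 2 := by
    by_contra! h
    nlinarith
  have hα'' : 7 / 5 < α := by
    by_contra! h
    nlinarith
  have hrec (n : ℕ) : (3 * α - 2) * narayana (n + 2) - α ^ (n + 2) =
      (1 - α) * ((3 * α - 2) * narayana (n + 1) - α ^ (n + 1)) -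
        (α ^ 2 - α) * ((3 * α - 2) * narayana n - α ^ n) := by
    have key : (narayana (n + 2) : ℝ) =
        (1 - α) * narayana (n + 1) - (α ^ 2 - α) * narayana n + α ^ n * α := by
      induction n with
      | zero => norm_num [narayana]
      | succ n ih =>
        have : (narayana (n + 1 + 2) : ℝ) = narayana (n + 2) + narayana n := by
          rw [show n + 1 + 2 = n + 3 by rfl, narayana]
          push_cast
          ring
        rw [this]
        have h3 : α * (α ^ 2 - α) = 1 := by linarith
        have : α ^ (n + 1) * α = α * (narayana (n + 2) - (1 - α) * narayana (n + 1)
          + (α ^ 2 - α) * narayana n) := by rw [ih]; ring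
        rw [this]
        linear_combination -(narayana n : ℝ) * h3
    rw [key]
    ring
  have hq0 : 0 ≤ α ^ 2 - α := by nlinarith
  have hq1 : α ^ 2 - α ≤ 1 := by nlinarith
  have hquad (n : ℕ) : ((3 * α - 2) * narayana (n + 1) - α ^ (n + 1)) ^ 2 -
      (1 - α) * ((3 * α - 2) * narayana n - α ^ n) *
        ((3 * α - 2) * narayana (n + 1) - α ^ (n + 1)) +
      (α ^ 2 - α) * ((3 * α - 2) * narayana n - α ^ n) ^ 2 =
      (α ^ 2 - α) ^ n * ((α - 1) * (3 * α - 2)) := by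
    induction n with
    | zero =>
      norm_num [narayana]
      ring
    | succ n ih =>
      rw [show n + 1 + 1 = n + 2 by rfl, hrec n]
      linear_combination (α ^ 2 - α) * ih
  have hle : (α ^ 2 - α) ^ n * ((α - 1) * (3 * α - 2)) ≤ 1 * ((α - 1) * (3 * α - 2)) := by
    gcongr
    · nlinarith
    · exact pow_le_one₀ hq0 hq1
  rw [← hquad n] at hle
  have hα1 : 0 < α - 1 := by linarith
  set f := (3 * α - 2) * narayana n - α ^ n
  set g := (3 * α - 2) * narayana (n + 1) - α ^ (n + 1)
  have hf : (α - 1) * ((3 * α + 1) * f ^ 2) ≤ (α - 1) * (4 * (3 * α - 2)) := by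
    linarith [sq_nonneg (2 * g - (1 - α) * f)]
  have hf' := le_of_mul_le_mul_left hf hα1
  refine abs_le_of_sq_le_sq (le_of_mul_le_mul_left (hf'.trans ?_) (by linarith : 0 < 3 * α + 1))
    (by linarith)
  have : 4 ≤ (3 * α + 1) * (3 * α - 2) := by nlinarith
  calc 4 * (3 * α - 2) ≤ (3 * α + 1) * (3 * α - 2) * (3 * α - 2) := by
        gcongr
        linarith
    _ = _ := by ring

/-- A repdigit concatenation forces a small value of the associated linear form in logarithms. -/
theorem abs_linear_form_le_of_near_power {α : ℝ} (h0 : 1 < α) (hα : α ^ 3 = α ^ 2 + 1)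
    {n d a b m : ℕ} (h1 : 1 ≤ d) (ha : a = m + b) (hm : 2 ≤ m)
    (h : |9 * (narayana n : ℝ) - d * 10 ^ a| ≤ 9 * 10 ^ b) :
    |n * Real.log α - a * Real.log 10 -
      (Real.log d + Real.log (3 * α - 2) - 2 * Real.log 3)| ≤ 36 / 10 ^ m := by
  have hc : 0 < 3 * α - 2 := by linarith
  have hα0 : 0 < α := by linarith
  have hd : (1 : ℝ) ≤ d := by exact_mod_cast h1
  have hB := abs_mul_narayana_sub_pow_le h0 hα n
  set D : ℝ := d * 10 ^ a * (3 * α - 2) with hD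
  have hD0 : 0 < D := by positivity
  have hm' : (10 : ℝ) ^ 2 ≤ 10 ^ m := pow_le_pow_right₀ (by norm_num) hm
  have hb1 : (1 : ℝ) ≤ 10 ^ b := one_le_pow₀ (by norm_num)
  have h1' : |9 * α ^ n - D| ≤ 18 * 10 ^ b * (3 * α - 2) := by
    have : 9 * α ^ n - D = (3 * α - 2) * (9 * narayana n - d * 10 ^ a) -
        9 * ((3 * α - 2) * narayana n - α ^ n) := by rw [hD]; ring
    rw [this]
    refine (abs_sub _ _).trans ?_
    rw [abs_mul, abs_mul, abs_of_pos hc, abs_of_pos (by norm_num : (0 : ℝ) < 9)]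
    nlinarith
  have hδ : |9 * α ^ n / D - 1| ≤ 18 / 10 ^ m := by
    rw [div_sub_one hD0.ne', abs_div, abs_of_pos hD0, div_le_div_iff₀ hD0 (by positivity)]
    calc |9 * α ^ n - D| * 10 ^ m ≤ 18 * 10 ^ b * (3 * α - 2) * 10 ^ m := by gcongr
      _ = 18 * (1 * 10 ^ a * (3 * α - 2)) := by rw [ha, pow_add]; ring
      _ ≤ 18 * D := by rw [hD]; gcongr
  have hδ' : (18 : ℝ) / 10 ^ m ≤ 18 / 10 ^ 2 := by gcongr
  have hl := abs_log_sub_log_le (c := 9 * α ^ n / D) (c₀ := 1)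
    (by have := abs_le.mp hδ; norm_num at this hδ' ⊢; linarith [this.1]) (by norm_num) hδ
  rw [hD, Real.log_one, sub_zero, Real.log_div (by positivity) (by positivity),
    Real.log_mul (by norm_num) (by positivity), Real.log_mul (by positivity) hc.ne',
    Real.log_mul (by positivity) (by positivity), Real.log_pow, Real.log_pow,
    show (9 : ℝ) = 3 ^ 2 by norm_num, Real.log_pow] at hl
  convert hl using 1
  · congr 1
    push_cast
    ring
  · ring

theorem mul_log_narayana_ratio_sub_mul_log_ten {α : ℝ} (h0 : 1 < α) (hα : α ^ 3 = α ^ 2 + 1) :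
    13 / 10 ^ 17 ≤ 32734689130744 * Real.log α - 5434185296691 * Real.log 10 ∧
      32734689130744 * Real.log α - 5434185296691 * Real.log 10 ≤ 14 / 10 ^ 17 := by
  have hl := log_narayana_ratio h0 hα
  obtain ⟨h2, -, h5⟩ := log_two_three_five
  rw [log_ten_eq]
  rw [abs_le] at hl h2 h5
  norm_num at hl h2 h5 ⊢
  constructor <;> linarith

theorem linear_form_bound_le_one {m : ℕ} (hm : 2 ≤ m) : (36 : ℝ) / 10 ^ m ≤ 1 := by
  rw [div_le_one (by positivity)]
  calc (36 : ℝ) ≤ 10 ^ 2 := by norm_num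
    _ ≤ 10 ^ m := pow_le_pow_right₀ (by norm_num) hm

/-- The linear form bound cannot hold once `n` exceeds `4 * 10 ^ 42`. -/
theorem index_le_of_linear_form_small {α : ℝ} (h0 : 1 < α) (hα : α ^ 3 = α ^ 2 + 1)
    {n a d m : ℕ} (h1 : 1 ≤ d) (h9 : d ≤ 9) (hm : 2 ≤ m) (ham : a ≤ 2 * m)
    (hΛ : |n * Real.log α - a * Real.log 10 -
      (Real.log d + Real.log (3 * α - 2) - 2 * Real.log 3)| ≤ 36 / 10 ^ m) :
    n ≤ 4 * 10 ^ 42 := by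
  by_contra! hn
  obtain ⟨β, hadd, hmul, hβ⟩ := exists_conjugate_narayana_ratio h0 hα
  obtain ⟨hw1, hw2⟩ := mul_log_narayana_ratio_sub_mul_log_ten h0 hα
  obtain ⟨w, hw⟩ : ∃ w, w = 32734689130744 * Real.log α - 5434185296691 * Real.log 10 := ⟨_, rfl⟩
  rw [← hw] at hw1 hw2
  obtain ⟨Λ, hΛeq⟩ : ∃ Λ, Λ = n * Real.log α - a * Real.log 10 -
      (Real.log d + Real.log (3 * α - 2) - 2 * Real.log 3) := ⟨_, rfl⟩
  rw [← hΛeq] at hΛ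
  obtain ⟨k, hk⟩ : ∃ k, k = n / 32734689130744 + 1 := ⟨_, rfl⟩
  have hnk : n < 32734689130744 * k := by
    rw [hk]
    exact Nat.lt_mul_div_succ n (by norm_num)
  have hkn : 32734689130744 * k ≤ n + 32734689130744 := by
    have := Nat.mul_div_le n 32734689130744
    omega
  obtain ⟨r, hr⟩ := Nat.exists_eq_add_of_le hnk.le
  have hr' : r ≤ 32734689130744 := by omega
  have hk29 : 122 * 10 ^ 27 ≤ k := by omega
  have hα0 : 0 < α := by linarith
  have hc : 0 < 3 * α - 2 := by linarith
  have hd : (1 : ℝ) ≤ d := by exact_mod_cast h1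
  have hd9 : (d : ℝ) ≤ 9 := by exact_mod_cast h9
  have hrR : (32734689130744 * k : ℝ) = n + r := by exact_mod_cast hr
  have hrR' : (r : ℝ) ≤ 32734689130744 := by exact_mod_cast hr'
  have hkR : (122 * 10 ^ 27 : ℝ) ≤ k := by exact_mod_cast hk29
  have hlogα := log_narayana_ratio h0 hα
  have hlogc := log_three_mul_narayana_ratio_sub_two h0 hα
  obtain ⟨hl2, hl3, hl5⟩ := log_two_three_five
  have hlogd0 : 0 ≤ Real.log d := Real.log_nonneg hd
  have hlogd1 : Real.log d ≤ 2 * Real.log 3 := by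
    calc Real.log d ≤ Real.log 9 := Real.log_le_log (by linarith) hd9
      _ = 2 * Real.log 3 := by
        rw [show (9 : ℝ) = 3 ^ 2 by norm_num, Real.log_pow]; norm_num
  have hlog10 := log_ten_eq
  have hΛ1 := hΛ.trans (linear_form_bound_le_one hm)
  rw [abs_le] at hlogα hlogc hl2 hl3 hl5 hΛ1
  norm_num at hlogα hlogc hl2 hl3 hl5 hw1 hw2 hkR
  have hα1 : Real.log α ≤ 39 / 100 := by linarith
  have hα2 : 0 ≤ Real.log α := by linarith
  have ht1 : 2 ≤ Real.log 10 := by linarith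
  have hc0 : 0 ≤ Real.log (3 * α - 2) := by linarith
  have hc1 : Real.log (3 * α - 2) ≤ 1 := by linarith
  have h31 : Real.log 3 ≤ 11 / 10 := by linarith
  have hkw : 122 * 10 ^ 27 * (13 / 10 ^ 17) ≤ k * w := by
    rw [mul_comm (k : ℝ), mul_comm]
    norm_num at hw1 ⊢
    calc (15860000000000 : ℝ) = 13 / 100000000000000000 * 122000000000000000000000000000 := by
          norm_num
      _ ≤ w * k := by
          gcongr
          exact_mod_cast hkR
  have hrα : r * Real.log α ≤ 32734689130744 * (39 / 100) := by gcongr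
  have hrα0 : 0 ≤ r * Real.log α := by positivity
  have key : (a - 5434185296691 * k) * Real.log 10 = k * w - r * Real.log α - Λ -
      (Real.log d + Real.log (3 * α - 2) - 2 * Real.log 3) := by
    rw [hw, hΛeq]
    linear_combination (-Real.log α) * hrR
  have hs0 : 5434185296691 * k ≤ a := by
    have : (0 : ℝ) ≤ (a - 5434185296691 * k) * Real.log 10 := by
      rw [key]
      norm_num at hkw hrα
      linarith
    have := nonneg_of_mul_nonneg_left this (by linarith)
    have : (5434185296691 * k : ℝ) ≤ a := by linarith
    exact_mod_cast this
  obtain ⟨s, hs⟩ := Nat.exists_eq_add_of_le hs0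
  have hsR : (a - 5434185296691 * k : ℝ) = s := by rw [hs]; push_cast; ring
  rw [hsR] at key
  have hsle : (s : ℝ) ≤ k * w + 3 := by
    have : 0 ≤ s * (Real.log 10 - 2) := by
      apply mul_nonneg (by positivity); linarith
    nlinarith
  refine linear_form_contradiction hα hadd hmul hβ (x := Real.exp w)
    (ρ := Real.exp (k * w + -Λ)) (lam := -Λ) (w := w) (N := 32734689130744) (A := 5434185296691)
    (r₀ := r) (s := s) (d := d) (k := k) (m₁ := m) ?_ ?_ h9 (by linarith) (by norm_num; linarith)
    rfl rfl (by norm_num) (by omega) hsle (by omega) ?_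
  · rw [hw, Real.exp_sub, ← Real.log_rpow hα0, ← Real.log_rpow (by norm_num),
      Real.exp_log (by positivity), Real.exp_log (by positivity)]
    norm_cast
  · have : k * w + -Λ = Real.log (10 ^ s * (d * (3 * α - 2) * α ^ r) / 9) := by
      rw [Real.log_div (by positivity) (by norm_num), Real.log_mul (by positivity) (by positivity),
        Real.log_mul (by positivity) (by positivity), Real.log_mul (by positivity) hc.ne',
        Real.log_pow, Real.log_pow, show (9 : ℝ) = 3 ^ 2 by norm_num, Real.log_pow]
      push_cast
      linarith
    rw [this, Real.exp_log (by positivity)]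
  · rw [abs_neg]
    refine hΛ.trans ?_
    gcongr
    norm_num

theorem abs_sub_mul_pow_le {N d1 d2 m1 m2 : ℕ} (h9 : d1 ≤ 9) (h9' : d2 ≤ 9)
    (h : 9 * N = d1 * (10 ^ m1 - 1) * 10 ^ m2 + d2 * (10 ^ m2 - 1)) :
    |(9 * N - d1 * 10 ^ (m1 + m2) : ℤ)| ≤ 9 * 10 ^ m2 := by
  have hZ : (9 * N : ℤ) = d1 * (10 ^ m1 - 1) * 10 ^ m2 + d2 * (10 ^ m2 - 1) := by
    have := congrArg (Nat.cast : ℕ → ℤ) h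
    push_cast [Nat.one_le_pow] at this
    exact this
  have h10 : (1 : ℤ) ≤ 10 ^ m2 := one_le_pow₀ (by norm_num)
  have hd1 : (d1 : ℤ) * 10 ^ m2 ≤ 9 * 10 ^ m2 := by gcongr; exact_mod_cast h9
  have hd2 : (d2 : ℤ) * (10 ^ m2 - 1) ≤ 9 * (10 ^ m2 - 1) := by
    gcongr
    exact_mod_cast h9'
  have hd1' : 0 ≤ (d1 : ℤ) * 10 ^ m2 := by positivity
  have hd2' : 0 ≤ (d2 : ℤ) * (10 ^ m2 - 1) := mul_nonneg (by positivity) (by linarith)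
  rw [hZ, pow_add, abs_le]
  constructor <;> linarith

theorem le_narayana_add_three : ∀ n, n + 1 ≤ narayana (n + 3)
  | 0 => by decide
  | 1 => by decide
  | 2 => by decide
  | n + 3 => by
    have h1 := le_narayana_add_three n
    have h2 := le_narayana_add_three (n + 2)
    have h3 : narayana (n + 3 + 3) = narayana (n + 3 + 2) + narayana (n + 3) := narayana.eq_4 _
    rw [h3]
    exact Nat.add_le_add h2 (by omega)

theorem index_le_of_exponent_le {α : ℝ} (h0 : 1 < α) (hα : α ^ 3 = α ^ 2 + 1)
    {n a d m : ℕ} (h1 : 1 ≤ d) (h9 : d ≤ 9) (hm : 2 ≤ m) (ha : a ≤ 96)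
    (hΛ : |n * Real.log α - a * Real.log 10 -
      (Real.log d + Real.log (3 * α - 2) - 2 * Real.log 3)| ≤ 36 / 10 ^ m) :
    n ≤ 650 := by
  have hlogd : Real.log d ≤ 2 * Real.log 3 := by
    calc Real.log d ≤ Real.log 9 :=
        Real.log_le_log (by exact_mod_cast h1) (by exact_mod_cast h9)
      _ = 2 * Real.log 3 := by
        rw [show (9 : ℝ) = 3 ^ 2 by norm_num, Real.log_pow]
        norm_num
  have hlogα := log_narayana_ratio h0 hα
  have hlogc := log_three_mul_narayana_ratio_sub_two h0 hα
  obtain ⟨hl2, -, hl5⟩ := log_two_three_five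
  have hlog10 := log_ten_eq
  have hΛ1 := hΛ.trans (linear_form_bound_le_one hm)
  rw [abs_le] at hlogα hlogc hl2 hl5 hΛ1
  norm_num at hlogα hlogc hl2 hl5
  have ht0 : 0 ≤ Real.log 10 := by linarith
  have ht1 : Real.log 10 ≤ 24 / 10 := by linarith
  have hc1 : Real.log (3 * α - 2) ≤ 1 := by linarith
  have hα1 : 38 / 100 ≤ Real.log α := by linarith
  have haR : (a : ℝ) ≤ 96 := by exact_mod_cast ha
  have hal : a * Real.log 10 ≤ 96 * (24 / 10) := by gcongr
  have hnl : n * (38 / 100) ≤ n * Real.log α := by gcongr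
  have : (n : ℝ) ≤ 650 := by linarith [hΛ1.2]
  exact_mod_cast this

/-- No Narayana number `N n` with `n > 250` is a concatenation of two repdigits. -/
theorem narayana_no_concat_large (n : ℕ) (hn : 250 < n) :
    ¬ ∃ d1 d2 m1 m2 : ℕ, 1 ≤ d1 ∧ d1 ≤ 9 ∧ d2 ≤ 9 ∧ m2 ≤ m1 ∧ 1 ≤ m2 ∧
      9 * narayana n = d1 * (10 ^ m1 - 1) * 10 ^ m2 + d2 * (10 ^ m2 - 1) := by
  rintro ⟨d, d2, m1, m2, h1, h9, h9', hm, hm2, h⟩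
  obtain ⟨α, h0, hα⟩ := exists_narayana_ratio
  have hZ := abs_sub_mul_pow_le h9 h9' h
  have hm1 : 2 ≤ m1 := by
    by_contra! hlt
    obtain rfl : m1 = 1 := by omega
    obtain rfl : m2 = 1 := by omega
    obtain ⟨i, rfl⟩ := Nat.exists_eq_add_of_le' (show 3 ≤ n by omega)
    have := le_narayana_add_three i
    omega
  have hR : |9 * (narayana n : ℝ) - d * 10 ^ (m1 + m2)| ≤ 9 * 10 ^ m2 := by exact_mod_cast hZ
  have hΛ := abs_linear_form_le_of_near_power h0 hα h1 rfl hm1 hR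
  have hn42 := index_le_of_linear_form_small h0 hα h1 h9 hm1 (by omega) hΛ
  have hm48 := exponent_le_of_linear_form_small h0 hα h1 h9 hn42 hΛ
  have ha : m1 + m2 ≤ 96 := by omega
  exact narayana_ne_of_le hn (index_le_of_exponent_le h0 hα h1 h9 hm1 ha hΛ) h1 h9 ha
    (by omega) (by omega) hZ
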